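/- arXiv:1405.5606 — 2 statements merged into one kernel-verified Lean document; each statement's English description precedes it below -/
import Mathlib

section
/- Let Δ ∈ {≤, =} and let k ∈ ℕ be fixed. The hierarchy of the families L_n := L(CD_n, CF[−λ], (t∧Δk)) with respect to the number of components n ∈ ℕ is infinite: for every n ∈ ℕ there exists m ∈ ℕ with m > n such that L_n ⊊ L_m; this holds both with and without erasing rules. -/
namespace CDHybrid

/-- Symbols: nonterminals are natural numbers, terminals come from `T`. -/
abbrev Symb (T : Type) := ℕ ⊕ T

/-- Sentential forms. -/
abbrev SForm (T : Type) := List (Symb T)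

/-- A context-free rule `A → z`. -/
abbrev Rule (T : Type) := ℕ × SForm T

/-- Number of nonterminal occurrences in a sentential form. -/
def ntCount {T : Type} (x : SForm T) : ℕ := (x.filter Sum.isLeft).length

/-- One rewriting step using some rule of the rule set `P`. -/
def RStep {T : Type} (P : List (Rule T)) (x y : SForm T) : Prop :=
  ∃ r ∈ P, ∃ u v : SForm T, x = u ++ Sum.inl r.1 :: v ∧ y = u ++ r.2 ++ v

/-- `m`-step derivation using only rules of `P`. -/
def StepsN {T : Type} (P : List (Rule T)) : ℕ → SForm T → SForm T → Prop
  | 0, x, y => x = y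
  | m + 1, x, y => ∃ z, RStep P x z ∧ StepsN P m z y

/-- `m`-step derivation using only rules of `P`, all intermediate (and the final)
sentential forms having at most `b` occurrences of nonterminals. -/
def StepsNB {T : Type} (P : List (Rule T)) (b : ℕ) : ℕ → SForm T → SForm T → Prop
  | 0, x, y => x = y
  | m + 1, x, y => ∃ z, RStep P x z ∧ ntCount z ≤ b ∧ StepsNB P b m z y

/-- Derivation modes of CD grammar systems. -/
inductive Mode where
  | eq : ℕ → Mode
  | le : ℕ → Mode
  | ge : ℕ → Mode
  | star : Mode
  | t : Mode
  | conj : Mode → Mode → Mode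

/-- The predicate of a derivation mode: `modeOK P f m y` holds if an `m`-step
derivation by the component `P` ending in `y` is acceptable for mode `f`. -/
def modeOK {T : Type} (P : List (Rule T)) : Mode → ℕ → SForm T → Prop
  | .eq k, m, _ => m = k
  | .le k, m, _ => m ≤ k
  | .ge k, m, _ => k ≤ m
  | .star, _, _ => True
  | .t, _, y => ¬ ∃ z, RStep P y z
  | .conj f g, m, y => modeOK P f m y ∧ modeOK P g m y

/-- A CD grammar system with context-free components. -/
structure CDGS (T : Type) where
  deg : ℕ
  start : ℕ
  comp : Fin deg → List (Rule T)

/-- λ-freeness: no erasing rules. -/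
def CDGS.LamFree {T : Type} (G : CDGS T) : Prop :=
  ∀ i : Fin G.deg, ∀ r ∈ G.comp i, r.2 ≠ []

/-- One derivation step of a component of `G` in mode `f`. -/
def CDGS.ModeStep {T : Type} (G : CDGS T) (f : Mode) (x y : SForm T) : Prop :=
  ∃ i : Fin G.deg, ∃ m : ℕ, StepsN (G.comp i) m x y ∧ modeOK (G.comp i) f m y

/-- One derivation step of a component of `G` in mode `f`, with all produced
sentential forms having at most `b` nonterminal occurrences. -/
def CDGS.ModeStepB {T : Type} (G : CDGS T) (f : Mode) (b : ℕ) (x y : SForm T) : Prop :=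
  ∃ i : Fin G.deg, ∃ m : ℕ, StepsNB (G.comp i) b m x y ∧ modeOK (G.comp i) f m y

/-- The language generated by `G` in mode `f`. -/
def CDGS.lang {T : Type} (G : CDGS T) (f : Mode) : Set (List T) :=
  { w | Relation.TransGen (G.ModeStep f) [Sum.inl G.start] (w.map Sum.inr) }

/-- The words of the language of `G` in mode `f` possessing a derivation of index
at most `b`, i.e., all sentential forms occurring in it have at most `b`
nonterminal occurrences. -/
def CDGS.langB {T : Type} (G : CDGS T) (f : Mode) (b : ℕ) : Set (List T) :=
  { w | ntCount ([Sum.inl G.start] : SForm T) ≤ b ∧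
      Relation.TransGen (G.ModeStepB f b) [Sum.inl G.start] (w.map Sum.inr) }

/-- Two languages are considered equal iff they differ at most in the empty word. -/
def EqL {T : Type} (L₁ L₂ : Set (List T)) : Prop := L₁ \ {[]} = L₂ \ {[]}

/-- The family `L(CD_n, CF[−λ], f)`; `lf = true` forbids erasing rules. -/
def CDFam (T : Type) (lf : Bool) (n : ℕ) (f : Mode) : Set (Set (List T)) :=
  { L | ∃ G : CDGS T, G.deg ≤ n ∧ (lf = true → G.LamFree) ∧ EqL (G.lang f) L }

/-- The family `L(CD_∞, CF[−λ], f)`. -/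
def CDFamInf (T : Type) (lf : Bool) (f : Mode) : Set (Set (List T)) :=
  { L | ∃ G : CDGS T, (lf = true → G.LamFree) ∧ EqL (G.lang f) L }

/-- The family `L_m(CD_n, CF[−λ], f)` of such languages of index at most `m`. -/
def CDFamInd (T : Type) (lf : Bool) (n : ℕ) (f : Mode) (m : ℕ) : Set (Set (List T)) :=
  { L | ∃ G : CDGS T, G.deg ≤ n ∧ (lf = true → G.LamFree) ∧ EqL (G.lang f) L ∧
      G.lang f ⊆ G.langB f m }

/-- The family `L_m(CD_∞, CF[−λ], f)`. -/
def CDFamIndInf (T : Type) (lf : Bool) (f : Mode) (m : ℕ) : Set (Set (List T)) :=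
  { L | ∃ G : CDGS T, (lf = true → G.LamFree) ∧ EqL (G.lang f) L ∧ G.lang f ⊆ G.langB f m }

/-- The family `L_fin(CD_∞, CF[−λ], f)`. -/
def CDFamFinInf (T : Type) (lf : Bool) (f : Mode) : Set (Set (List T)) :=
  { L | ∃ m : ℕ, 1 ≤ m ∧ L ∈ CDFamIndInf T lf f m }

/-- A context-free grammar. -/
structure CFG (T : Type) where
  start : ℕ
  rules : List (Rule T)

/-- The language generated by a context-free grammar. -/
def CFG.lang {T : Type} (G : CFG T) : Set (List T) :=
  { w | Relation.ReflTransGen (RStep G.rules) [Sum.inl G.start] (w.map Sum.inr) }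

/-- The words of `G.lang` having a derivation of index at most `m`. -/
def CFG.langB {T : Type} (G : CFG T) (m : ℕ) : Set (List T) :=
  { w | ntCount ([Sum.inl G.start] : SForm T) ≤ m ∧
      Relation.ReflTransGen (fun x y => RStep G.rules x y ∧ ntCount y ≤ m)
        [Sum.inl G.start] (w.map Sum.inr) }

/-- The family `L(CF)` of context-free languages. -/
def CFFam (T : Type) : Set (Set (List T)) := { L | ∃ G : CFG T, EqL G.lang L }

/-- The family `L_m(CF)` of context-free languages of index at most `m`. -/
def CFFamInd (T : Type) (m : ℕ) : Set (Set (List T)) :=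
  { L | ∃ G : CFG T, EqL G.lang L ∧ G.lang ⊆ G.langB m }

/-- The family `L_fin(CF)` of context-free languages of finite index. -/
def CFFamFin (T : Type) : Set (Set (List T)) :=
  { L | ∃ m : ℕ, 1 ≤ m ∧ L ∈ CFFamInd T m }

/-- A grammar is linear if every right-hand side contains at most one nonterminal. -/
def CFG.Linear {T : Type} (G : CFG T) : Prop := ∀ r ∈ G.rules, ntCount r.2 ≤ 1

/-- The family `L(LIN)` of linear context-free languages. -/
def LinFam (T : Type) : Set (Set (List T)) :=
  { L | ∃ G : CFG T, G.Linear ∧ EqL G.lang L }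

/-- The family `L(FIN)` of finite languages. -/
def FinFam (T : Type) : Set (Set (List T)) := { L | L.Finite }

/-- A programmed grammar with context-free rules. -/
structure PG (T : Type) where
  start : ℕ
  nLab : ℕ
  rule : Fin nLab → Rule T
  succ : Fin nLab → Set (Fin nLab)
  fail : Fin nLab → Set (Fin nLab)

def PG.LamFree {T : Type} (G : PG T) : Prop := ∀ r : Fin G.nLab, (G.rule r).2 ≠ []

/-- No appearance checking: all failure fields are empty. -/
def PG.NoAC {T : Type} (G : PG T) : Prop := ∀ r : Fin G.nLab, G.fail r = ∅

/-- One step of a programmed grammar on pairs (sentential form, label). -/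
def PG.PStep {T : Type} (G : PG T) (p q : SForm T × Fin G.nLab) : Prop :=
  (∃ u v : SForm T, p.1 = u ++ Sum.inl (G.rule p.2).1 :: v ∧
      q.1 = u ++ (G.rule p.2).2 ++ v ∧ q.2 ∈ G.succ p.2) ∨
  (Sum.inl (G.rule p.2).1 ∉ p.1 ∧ q.1 = p.1 ∧ q.2 ∈ G.fail p.2)

/-- The language generated by a programmed grammar. -/
def PG.lang {T : Type} (G : PG T) : Set (List T) :=
  { w | ∃ r₁ r₂ : Fin G.nLab,
      Relation.ReflTransGen G.PStep ([Sum.inl G.start], r₁) (w.map Sum.inr, r₂) }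

/-- The words of `G.lang` having a derivation of index at most `m`. -/
def PG.langB {T : Type} (G : PG T) (m : ℕ) : Set (List T) :=
  { w | ∃ r₁ r₂ : Fin G.nLab, ntCount ([Sum.inl G.start] : SForm T) ≤ m ∧
      Relation.ReflTransGen (fun p q => G.PStep p q ∧ ntCount q.1 ≤ m)
        ([Sum.inl G.start], r₁) (w.map Sum.inr, r₂) }

/-- The family `L_m(P, CF[−λ][, ac])`: programmed languages of index at most `m`;
`ac = false` forbids appearance checking, `lf = true` forbids erasing rules. -/
def PFamInd (T : Type) (lf ac : Bool) (m : ℕ) : Set (Set (List T)) :=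
  { L | ∃ G : PG T, (lf = true → G.LamFree) ∧ (ac = false → G.NoAC) ∧
      EqL G.lang L ∧ G.lang ⊆ G.langB m }

/-- The family `L_fin(P, CF[−λ][, ac])` of programmed languages of finite index. -/
def PFamFin (T : Type) (lf ac : Bool) : Set (Set (List T)) :=
  { L | ∃ m : ℕ, 1 ≤ m ∧ L ∈ PFamInd T lf ac m }


/-! Helper material. -/

def nts (x : SForm ℕ) : List ℕ := x.filterMap Sum.getLeft?

def tc (j : ℕ) (x : SForm ℕ) : ℕ := (x.filterMap Sum.getRight?).count j

theorem nts_append (x y : SForm ℕ) : nts (x ++ y) = nts x ++ nts y := by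
  simp [nts]

theorem nts_inl (A : ℕ) (y : SForm ℕ) : nts (Sum.inl A :: y) = A :: nts y := by
  simp [nts]

theorem nts_inr (A : ℕ) (y : SForm ℕ) : nts (Sum.inr A :: y) = nts y := by
  unfold nts; rw [List.filterMap_cons_none rfl]

theorem mem_nts (A : ℕ) (x : SForm ℕ) : A ∈ nts x ↔ Sum.inl A ∈ x := by
  simp [nts]

theorem nts_map_inr (w : List ℕ) : nts (w.map Sum.inr) = [] := by
  induction w with
  | nil => rfl
  | cons a w ih => simp [nts_inr, ih]

theorem tc_append (j : ℕ) (x y : SForm ℕ) : tc j (x ++ y) = tc j x + tc j y := by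
  simp [tc]

theorem tc_inl (j A : ℕ) (y : SForm ℕ) : tc j (Sum.inl A :: y) = tc j y := by
  unfold tc; rw [List.filterMap_cons_none rfl]

theorem tc_inr (j A : ℕ) (y : SForm ℕ) :
    tc j (Sum.inr A :: y) = tc j y + if A = j then 1 else 0 := by
  unfold tc; rw [List.filterMap_cons_some (f := Sum.getRight?) (a := Sum.inr A) (b := A) rfl, List.count_cons]; simp

theorem tc_pos (j : ℕ) (x : SForm ℕ) : 0 < tc j x ↔ Sum.inr j ∈ x := by
  simp [tc]

theorem tc_map_inr (j : ℕ) (w : List ℕ) : tc j (w.map Sum.inr) = w.count j := by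
  induction w with
  | nil => rfl
  | cons a w ih => simp [tc_inr, ih, List.count_cons]

theorem eq_map_of_nts_nil (x : SForm ℕ) (h : nts x = []) : ∃ w : List ℕ, x = w.map Sum.inr := by
  induction x with
  | nil => exact ⟨[], rfl⟩
  | cons a x ih =>
    cases a with
    | inl A => simp [nts_inl] at h
    | inr a =>
      rw [nts_inr] at h
      obtain ⟨w, rfl⟩ := ih h
      exact ⟨a :: w, rfl⟩

theorem step_sim {P : List (Rule ℕ)} {x y x' : SForm ℕ} (h : RStep P x y) (hx : nts x' = nts x) :
    ∃ y', RStep P x' y' ∧ nts y' = nts y ∧ ∀ j, tc j y' + tc j x = tc j y + tc j x' := by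
  obtain ⟨r, hr, u, v, rfl, rfl⟩ := h
  rw [nts_append, nts_inl] at hx
  obtain ⟨u', w', rfl, hu, hw⟩ := List.filterMap_eq_append_iff.1 hx
  obtain ⟨l1, a, v', rfl, hl1, ha, hv⟩ := List.filterMap_eq_cons_iff.1 hw
  cases a with
  | inr a => simp at ha
  | inl A =>
    simp at ha
    subst ha
    refine ⟨(u' ++ l1) ++ r.2 ++ v', ⟨r, hr, u' ++ l1, v', by simp, rfl⟩, ?_, ?_⟩
    · have h1 : nts l1 = [] := by
        unfold nts; rw [List.filterMap_eq_nil_iff]; exact hl1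
      have h2 : nts u' = nts u := hu
      have h3 : nts v' = nts v := hv
      simp only [nts_append, h1, h2, h3, List.append_nil]
    · intro j
      simp only [tc_append, tc_inl]
      omega

theorem steps_sim {P : List (Rule ℕ)} (m : ℕ) : ∀ {x y x' : SForm ℕ}, StepsN P m x y →
    nts x' = nts x →
    ∃ y', StepsN P m x' y' ∧ nts y' = nts y ∧ ∀ j, tc j y' + tc j x = tc j y + tc j x' := by
  induction m with
  | zero =>
    intro x y x' h hx
    have h : x = y := h
    subst h
    exact ⟨x', rfl, hx, fun j => by omega⟩
  | succ m ih =>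
    rintro x y x' ⟨z, hz, hzy⟩ hx
    obtain ⟨z', h1, h2, h3⟩ := step_sim hz hx
    obtain ⟨y', h4, h5, h6⟩ := ih hzy h2
    refine ⟨y', ⟨z', h1, h4⟩, h5, fun j => ?_⟩
    have := h3 j
    have := h6 j
    omega

theorem modeOK_sim {P : List (Rule ℕ)} (f : Mode) (m : ℕ) {y y' : SForm ℕ}
    (hy : nts y' = nts y) (h : modeOK P f m y) : modeOK P f m y' := by
  induction f with
  | t =>
    rintro ⟨z, hz⟩
    obtain ⟨z', h1, -⟩ := step_sim hz hy.symm
    exact h ⟨z', h1⟩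
  | conj f g ihf ihg => exact ⟨ihf h.1, ihg h.2⟩
  | eq k => exact h
  | le k => exact h
  | ge k => exact h
  | star => exact h

theorem deriv_sim {G : CDGS ℕ} {f : Mode} {x y x' : SForm ℕ}
    (h : Relation.ReflTransGen (G.ModeStep f) x y) (hx : nts x' = nts x) :
    ∃ y', Relation.ReflTransGen (G.ModeStep f) x' y' ∧ nts y' = nts y ∧
      ∀ j, tc j y' + tc j x = tc j y + tc j x' := by
  induction h with
  | refl => exact ⟨x', .refl, hx, fun j => by omega⟩
  | tail _ hs ih =>
    obtain ⟨z', h1, h2, h3⟩ := ih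
    obtain ⟨i, m, hm, hok⟩ := hs
    obtain ⟨y', h4, h5, h6⟩ := steps_sim m hm h2
    refine ⟨y', h1.tail ⟨i, m, h4, modeOK_sim f m h5 hok⟩, h5, fun j => ?_⟩
    have := h3 j
    have := h6 j
    omega

/-- `w` arises from `x` by replacing nonterminals by words. -/
inductive Sub : SForm ℕ → List ℕ → Prop
  | nil : Sub [] []
  | term (a : ℕ) {x w} : Sub x w → Sub (Sum.inr a :: x) (a :: w)
  | nt (A : ℕ) (p : List ℕ) {x w} : Sub x w → Sub (Sum.inl A :: x) (p ++ w)

theorem Sub.self (w : List ℕ) : Sub (w.map Sum.inr) w := by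
  induction w with
  | nil => exact .nil
  | cons a w ih => exact .term a ih

theorem Sub.append {x y : SForm ℕ} {w v : List ℕ} (h : Sub x w) (h' : Sub y v) :
    Sub (x ++ y) (w ++ v) := by
  induction h with
  | nil => exact h'
  | term a _ ih => exact .term a ih
  | nt A p _ ih => rw [List.append_assoc]; exact .nt A p ih

theorem Sub.split {x y : SForm ℕ} {w : List ℕ} (h : Sub (x ++ y) w) :
    ∃ w1 w2, w = w1 ++ w2 ∧ Sub x w1 ∧ Sub y w2 := by
  induction x generalizing w with
  | nil => exact ⟨[], w, rfl, .nil, h⟩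
  | cons a x ih =>
    cases h with
    | term a h =>
      obtain ⟨w1, w2, rfl, h1, h2⟩ := ih h
      exact ⟨a :: w1, w2, rfl, .term a h1, h2⟩
    | nt A p h =>
      obtain ⟨w1, w2, rfl, h1, h2⟩ := ih h
      exact ⟨p ++ w1, w2, by simp, .nt A p h1, h2⟩

theorem Sub.step {P : List (Rule ℕ)} {x y : SForm ℕ} {w : List ℕ} (h : RStep P x y)
    (hw : Sub y w) : Sub x w := by
  obtain ⟨r, hr, u, v, rfl, rfl⟩ := h
  obtain ⟨w1, w2, rfl, h1, h2⟩ := hw.split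
  obtain ⟨w3, w4, rfl, h3, h4⟩ := h1.split
  rw [List.append_assoc]
  exact h3.append (.nt _ _ h2)

theorem Sub.steps {P : List (Rule ℕ)} (m : ℕ) {x y : SForm ℕ} {w : List ℕ} (h : StepsN P m x y)
    (hw : Sub y w) : Sub x w := by
  induction m generalizing x with
  | zero => have h : x = y := h; exact h ▸ hw
  | succ m ih =>
    obtain ⟨z, hz, hzy⟩ := h
    exact Sub.step hz (ih hzy)

theorem Sub.deriv {G : CDGS ℕ} {f : Mode} {x : SForm ℕ} {w : List ℕ}
    (h : Relation.ReflTransGen (G.ModeStep f) x (w.map Sum.inr)) : Sub x w := by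
  induction h using Relation.ReflTransGen.head_induction_on with
  | refl => exact Sub.self w
  | head hs _ ih =>
    obtain ⟨i, m, hm, -⟩ := hs
    exact Sub.steps m hm ih

theorem Sub.tc_le {x : SForm ℕ} {w : List ℕ} (h : Sub x w) (j : ℕ) : tc j x ≤ w.count j := by
  induction h with
  | nil => simp [tc]
  | term a _ ih =>
    simp only [tc_inr, List.count_cons, beq_iff_eq]
    omega
  | nt A p _ ih => rw [tc_inl, List.count_append]; omega

theorem Sub.mem {x : SForm ℕ} {w : List ℕ} (h : Sub x w) {j : ℕ} (hj : Sum.inr j ∈ x) : j ∈ w := by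
  have h1 := h.tc_le j
  have h2 : 0 < tc j x := (tc_pos j x).2 hj
  exact List.count_pos_iff.1 (by omega)

/-- Few letters are still being produced. -/
theorem Sub.bad {x : SForm ℕ} {w : List ℕ} (h : Sub x w) : ∀ c : ℕ, w.Pairwise (· ≤ ·) →
    (∀ a ∈ w, c ≤ a) → (∀ a ∈ w, a ≠ c → Sum.inr a ∈ x) →
    ∃ B : Finset ℕ, B.card ≤ 2 * (nts x).length ∧ ∀ j, j ∉ B → tc j x = w.count j := by
  induction h with
  | nil => intro c _ _ _; exact ⟨∅, by simp, fun j _ => by simp [tc]⟩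
  | @term a x w h ih =>
    intro c hs hc hm
    rw [List.pairwise_cons] at hs
    obtain ⟨B, hB, hB'⟩ := ih a hs.2 hs.1 (by
      intro b hb hba
      have h1 := hs.1 b hb
      have h2 := hc a (by simp)
      have h3 := hm b (by simp [hb]) (by omega)
      simpa [hba] using h3)
    refine ⟨B, by rwa [nts_inr], fun j hj => ?_⟩
    have := hB' j hj
    simp only [tc_inr, List.count_cons, beq_iff_eq]
    omega
  | @nt A p x w h ih =>
    intro c hs hc hm
    rw [List.pairwise_append] at hs
    obtain ⟨B, hB, hB'⟩ := ih c hs.2.1 (fun a ha => hc a (by simp [ha])) (by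
      intro b hb hbc
      simpa using hm b (by simp [hb]) hbc)
    have key : ∀ a ∈ p, a ≠ c → ∀ b ∈ p, b ≤ a := by
      intro a ha hac b hb
      have h1 := hm a (by simp [ha]) hac
      have h2 : a ∈ w := h.mem (by simpa using h1)
      exact hs.2.2 b hb a h2
    refine ⟨({c} ∪ {p.foldr max 0}) ∪ B, ?_, fun j hj => ?_⟩
    · rw [nts_inl, List.length_cons]
      have h1 := Finset.card_union_le (({c} : Finset ℕ) ∪ {p.foldr max 0}) B
      have h2 := Finset.card_union_le ({c} : Finset ℕ) {p.foldr max 0}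
      simp only [Finset.card_singleton] at h2
      omega
    · simp only [Finset.mem_union, Finset.mem_singleton, not_or] at hj
      rw [tc_inl, List.count_append, hB' j hj.2]
      have : j ∉ p := by
        intro hjp
        apply hj.1.2
        have h1 := key j hjp hj.1.1
        apply le_antisymm
        · clear key h1 hc hm hs hj
          induction p with
          | nil => simp at hjp
          | cons b p ihp =>
            simp only [List.foldr_cons]
            rcases List.mem_cons.1 hjp with rfl | h
            · exact le_max_left _ _
            · exact le_trans (ihp h) (le_max_right _ _)
        · clear key hc hm hs hjp hj
          induction p with
          | nil => simp
          | cons b p ihp =>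
            simp only [List.foldr_cons]
            exact max_le (h1 b (by simp)) (ihp (fun b hb => h1 b (by simp [hb])))
      simp [List.count_eq_zero_of_not_mem this]

theorem step_count_out {P : List (Rule ℕ)} {x y : SForm ℕ} (p : ℕ → Bool)
    (hp : ∀ r ∈ P, p r.1 = false) (h : RStep P x y) :
    (nts x).countP p ≤ (nts y).countP p := by
  obtain ⟨r, hr, u, v, rfl, rfl⟩ := h
  simp only [nts_append, nts_inl, List.countP_append, List.countP_cons, hp r hr]
  simp

theorem step_count_any {P : List (Rule ℕ)} {x y : SForm ℕ} (p : ℕ → Bool) (h : RStep P x y) :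
    (nts x).countP p ≤ (nts y).countP p + 1 := by
  obtain ⟨r, hr, u, v, rfl, rfl⟩ := h
  simp only [nts_append, nts_inl, List.countP_append, List.countP_cons]
  split_ifs <;> omega

theorem steps_count_out {P : List (Rule ℕ)} (m : ℕ) {x y : SForm ℕ} (p : ℕ → Bool)
    (hp : ∀ r ∈ P, p r.1 = false) (h : StepsN P m x y) :
    (nts x).countP p ≤ (nts y).countP p := by
  induction m generalizing x with
  | zero => have h : x = y := h; rw [h]
  | succ m ih =>
    obtain ⟨z, hz, hzy⟩ := h
    exact (step_count_out p hp hz).trans (ih hzy)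

theorem steps_count_any {P : List (Rule ℕ)} (m : ℕ) {x y : SForm ℕ} (p : ℕ → Bool)
    (h : StepsN P m x y) :
    (nts x).countP p ≤ (nts y).countP p + m := by
  induction m generalizing x with
  | zero => have h : x = y := h; rw [h]; simp
  | succ m ih =>
    obtain ⟨z, hz, hzy⟩ := h
    have := step_count_any p hz
    have := ih hzy
    omega

theorem no_step {P : List (Rule ℕ)} {y : SForm ℕ} (h : ¬ ∃ z, RStep P y z) {A : ℕ}
    (hA : Sum.inl A ∈ y) : ∀ r ∈ P, r.1 ≠ A := by
  rintro r hr rfl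
  obtain ⟨u, v, rfl⟩ := List.append_of_mem hA
  exact h ⟨_, r, hr, u, v, rfl, rfl⟩

open Classical in
theorem index_assign {G : CDGS ℕ} {f : Mode} {k : ℕ}
    (hf : ∀ (P : List (Rule ℕ)) m y, modeOK P f m y → m ≤ k ∧ ¬ ∃ z, RStep P y z)
    (i0 : Fin G.deg) {x : SForm ℕ} {w : List ℕ}
    (h : Relation.ReflTransGen (G.ModeStep f) x (w.map Sum.inr)) :
    ∃ g : ℕ → Fin G.deg, (∀ i, (nts x).countP (fun A => decide (g A = i)) ≤ k) ∧
      ∀ A ∈ nts x, ∃ r ∈ G.comp (g A), r.1 = A := by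
  induction h using Relation.ReflTransGen.head_induction_on with
  | refl => exact ⟨fun _ => i0, by simp [nts_map_inr], by simp [nts_map_inr]⟩
  | @head x y hs _ ih =>
    obtain ⟨g, hg1, hg2⟩ := ih
    obtain ⟨i, m, hm, hok⟩ := hs
    obtain ⟨hmk, hns⟩ := hf _ _ _ hok
    have hy0 : ∀ A ∈ nts y, ¬ ∃ r ∈ G.comp i, r.1 = A := by
      rintro A hA ⟨r, hr, e⟩
      exact no_step hns ((mem_nts A y).1 hA) r hr e
    have hsurv : ∀ A ∈ nts x, (¬ ∃ r ∈ G.comp i, r.1 = A) → A ∈ nts y := by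
      intro A hA hn
      have h1 := steps_count_out m (fun B => decide (B = A)) (by
        intro r hr
        simp only [decide_eq_false_iff_not]
        exact fun e => hn ⟨r, hr, e⟩) hm
      have h2 : 0 < (nts x).countP (fun B => decide (B = A)) :=
        List.countP_pos_iff.2 ⟨A, hA, by simp⟩
      obtain ⟨B, hB, hBA⟩ := List.countP_pos_iff.1 (h2.trans_le h1)
      simp only [decide_eq_true_eq] at hBA
      exact hBA ▸ hB
    refine ⟨fun A => if ∃ r ∈ G.comp i, r.1 = A then i else g A, fun j => ?_, fun A hA => ?_⟩
    · by_cases hj : j = i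
      · subst hj
        have h1 := steps_count_any m (fun A => decide (∃ r ∈ G.comp j, r.1 = A)) hm
        have h2 : (nts y).countP (fun A => decide (∃ r ∈ G.comp j, r.1 = A)) = 0 := by
          rw [List.countP_eq_zero]
          intro A hA
          simpa using hy0 A hA
        have h3 : (nts x).countP
            (fun A => decide ((if ∃ r ∈ G.comp j, r.1 = A then j else g A) = j)) ≤
            (nts x).countP (fun A => decide (∃ r ∈ G.comp j, r.1 = A)) := by
          apply List.countP_mono_left
          intro A hA h4
          simp only [decide_eq_true_eq] at h4 ⊢
          by_contra h5
          rw [if_neg h5] at h4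
          have h6 := hg2 A (hsurv A hA h5)
          rw [h4] at h6
          exact h5 h6
        exact h3.trans (by omega)
      · have h1 := steps_count_out m
          (fun A => decide ((¬ ∃ r ∈ G.comp i, r.1 = A) ∧ g A = j)) (by
          intro r hr
          simp only [decide_eq_false_iff_not]
          exact fun e => e.1 ⟨r, hr, rfl⟩) hm
        refine le_trans ?_ (h1.trans (le_trans ?_ (hg1 j)))
        · apply List.countP_mono_left
          intro A hA h4
          simp only [decide_eq_true_eq] at h4 ⊢
          split_ifs at h4 with h5
          · exact absurd h4.symm hj
          · exact ⟨h5, h4⟩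
        · apply List.countP_mono_left
          intro A hA h4
          simp only [decide_eq_true_eq] at h4 ⊢
          exact h4.2
    · by_cases h5 : ∃ r ∈ G.comp i, r.1 = A
      · simp only [if_pos h5]; exact h5
      · simp only [if_neg h5]; exact hg2 A (hsurv A hA h5)

theorem length_le_sum {n : ℕ} (g : ℕ → Fin n) (l : List ℕ) :
    l.length ≤ ∑ i, l.countP (fun A => decide (g A = i)) := by
  induction l with
  | nil => simp
  | cons a l ih =>
    simp only [List.countP_cons, List.length_cons, Finset.sum_add_distrib]
    simpa using ih

theorem index_bound {G : CDGS ℕ} {f : Mode} {k : ℕ}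
    (hf : ∀ (P : List (Rule ℕ)) m y, modeOK P f m y → m ≤ k ∧ ¬ ∃ z, RStep P y z)
    {x : SForm ℕ} {w : List ℕ}
    (h : Relation.ReflTransGen (G.ModeStep f) x (w.map Sum.inr)) :
    (nts x).length ≤ G.deg * k := by
  rcases Relation.ReflTransGen.cases_head h with rfl | ⟨c, ⟨i0, -⟩, -⟩
  · simp [nts_map_inr]
  · obtain ⟨g, hg, -⟩ := index_assign hf i0 h
    refine (length_le_sum g _).trans ((Finset.sum_le_sum (fun i _ => ?_)).trans
      (b := ∑ i : Fin G.deg, k) (by simp))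
    convert hg i

theorem steps_prop {P : List (Rule ℕ)} (p : SForm ℕ → SForm ℕ → Prop) (hr : ∀ x, p x x)
    (ht : ∀ x y z, RStep P x y → p y z → p x z) (m : ℕ) {x y : SForm ℕ} (h : StepsN P m x y) :
    p x y := by
  induction m generalizing x with
  | zero => have h : x = y := h; rw [h]; exact hr y
  | succ m ih =>
    obtain ⟨z, hz, hzy⟩ := h
    exact ht _ _ _ hz (ih hzy)

theorem exists_alphabet (G : CDGS ℕ) (f : Mode) : ∃ V : Finset ℕ, ∀ x,
    Relation.ReflTransGen (G.ModeStep f) [Sum.inl G.start] x → ∀ A ∈ nts x, A ∈ V := by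
  classical
  refine ⟨insert G.start (Finset.univ.biUnion fun i =>
    ((G.comp i).flatMap (fun r => nts r.2)).toFinset), fun x h => ?_⟩
  set V := insert G.start (Finset.univ.biUnion fun i =>
    ((G.comp i).flatMap (fun r => nts r.2)).toFinset) with hV
  induction h with
  | refl => simp [nts, hV]
  | tail _ hs ih =>
    obtain ⟨i, m, hm, -⟩ := hs
    refine steps_prop (P := G.comp i)
      (fun x y => (∀ A ∈ nts x, A ∈ V) → (∀ A ∈ nts y, A ∈ V)) (fun _ h => h) ?_ m hm ih
    intro x y z hxy hyz hx
    apply hyz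
    obtain ⟨r, hr, u, v, rfl, rfl⟩ := hxy
    intro A hA
    simp only [nts_append, nts_inl, List.mem_append, List.mem_cons] at hA hx
    rcases hA with (hA | hA) | hA
    · exact hx A (Or.inl hA)
    · rw [hV]
      apply Finset.mem_insert_of_mem
      rw [Finset.mem_biUnion]
      refine ⟨i, Finset.mem_univ _, ?_⟩
      rw [List.mem_toFinset, List.mem_flatMap]
      exact ⟨r, hr, hA⟩
    · exact hx A (Or.inr (Or.inr hA))

theorem finite_lists (V : Finset ℕ) (N : ℕ) :
    {l : List ℕ | l.length ≤ N ∧ ∀ a ∈ l, a ∈ V}.Finite := by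
  refine ((List.finite_length_le V N).image (List.map Subtype.val)).subset ?_
  rintro l ⟨h1, h2⟩
  refine ⟨l.attach.map (fun a => ⟨a.1, h2 a.1 a.2⟩), by simpa using h1, ?_⟩
  simp [List.map_map, Function.comp_def]

theorem exists_rhs_bound (G : CDGS ℕ) : ∃ R : ℕ, ∀ i, ∀ r ∈ G.comp i, ∀ j, tc j r.2 ≤ R := by
  refine ⟨∑ i, ((G.comp i).map (fun r => r.2.length)).sum, fun i r hr j => ?_⟩
  have h1 : tc j r.2 ≤ r.2.length := List.count_le_length.trans (List.length_filterMap_le _ _)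
  have h2 : r.2.length ≤ ((G.comp i).map (fun r => r.2.length)).sum :=
    List.le_sum_of_mem (List.mem_map.2 ⟨r, hr, rfl⟩)
  have h3 := Finset.single_le_sum (f := fun i => ((G.comp i).map (fun r => r.2.length)).sum)
    (fun i _ => Nat.zero_le _) (Finset.mem_univ i)
  exact h1.trans (h2.trans h3)

theorem steps_tc {P : List (Rule ℕ)} {R : ℕ} (hR : ∀ r ∈ P, ∀ j, tc j r.2 ≤ R) (m : ℕ)
    {x y : SForm ℕ} (h : StepsN P m x y) (j : ℕ) : tc j y ≤ tc j x + m * R := by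
  induction m generalizing x with
  | zero => have h : x = y := h; rw [h]; simp
  | succ m ih =>
    obtain ⟨z, ⟨r, hr, u, v, rfl, rfl⟩, hzy⟩ := h
    have h1 := ih hzy
    have h2 := hR r hr j
    simp only [tc_append, tc_inl] at *
    rw [Nat.succ_mul]
    omega

theorem exists_crossing {α : Type*} {r : α → α → Prop} {p : α → Prop} {a b : α}
    (h : Relation.ReflTransGen r a b) (ha : ¬ p a) (hb : p b) :
    ∃ c d, Relation.ReflTransGen r a c ∧ r c d ∧ Relation.ReflTransGen r d b ∧ ¬ p c ∧ p d := by
  induction h with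
  | refl => exact absurd hb ha
  | @tail c d h1 h2 ih =>
    by_cases hc : p c
    · obtain ⟨c', d', h3, h4, h5, h6, h7⟩ := ih hc
      exact ⟨c', d', h3, h4, h5.tail h2, h6, h7⟩
    · exact ⟨c, d, h1, h2, .refl, hc, hb⟩

/-- Words with blocks of nearly equal length. -/
def Bal (M : ℕ) (w : List ℕ) : Prop :=
  w.Pairwise (· ≤ ·) ∧ (∀ a ∈ w, a < M) ∧ ∀ j < M, ∀ l < M, w.count j ≤ w.count l + 2

theorem not_unbounded {G : CDGS ℕ} {f : Mode} {k M : ℕ}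
    (hf : ∀ (P : List (Rule ℕ)) m y, modeOK P f m y → m ≤ k ∧ ¬ ∃ z, RStep P y z)
    (hM : 2 * (G.deg * k) < M) (hL : ∀ w ∈ G.lang f, Bal M w) :
    ∃ C, ∀ w ∈ G.lang f, w.count 0 ≤ C := by
  have toLang : ∀ w : List ℕ,
      Relation.ReflTransGen (G.ModeStep f) [Sum.inl G.start] (w.map Sum.inr) → w ∈ G.lang f := by
    intro w h
    rcases Relation.reflTransGen_iff_eq_or_transGen.1 h with h | h
    · exfalso
      have := nts_map_inr w
      rw [h] at this
      simp [nts_inl] at this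
    · exact h
  let good : SForm ℕ → Prop := fun x =>
    Relation.ReflTransGen (G.ModeStep f) [Sum.inl G.start] x ∧
    ∃ w : List ℕ, Relation.ReflTransGen (G.ModeStep f) x (w.map Sum.inr)
  have swap : ∀ x x', good x → good x' → nts x' = nts x → ∀ j < M, ∀ l < M,
      tc j x' + tc l x ≤ tc l x' + tc j x + 4 := by
    rintro x x' ⟨hx1, w, hx2⟩ ⟨hx1', -⟩ hn j hj l hl
    obtain ⟨y', h1, h2, h3⟩ := deriv_sim hx2 hn
    rw [nts_map_inr] at h2
    obtain ⟨w', rfl⟩ := eq_map_of_nts_nil y' h2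
    have hw := (hL w (toLang w (hx1.trans hx2))).2.2 l hl j hj
    have hw' := (hL w' (toLang w' (hx1'.trans h1))).2.2 j hj l hl
    have e1 := h3 j
    have e2 := h3 l
    simp only [tc_map_inr] at e1 e2
    omega
  obtain ⟨V, hV⟩ := exists_alphabet G f
  obtain ⟨R, hR⟩ := exists_rhs_bound G
  have hfin := finite_lists V (G.deg * k)
  have hD0 : ∀ s : List ℕ, ∃ D, ∀ x, good x → nts x = s → ∀ j < M, ∀ l < M,
      tc j x ≤ tc l x + D := by
    intro s
    by_cases hs : ∃ x, good x ∧ nts x = s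
    · obtain ⟨x0, hx0, rfl⟩ := hs
      refine ⟨x0.length + 4, fun x hx hn j hj l hl => ?_⟩
      have h1 := swap x0 x hx0 hx hn j hj l hl
      have h2 : tc j x0 ≤ x0.length := List.count_le_length.trans (List.length_filterMap_le _ _)
      omega
    · exact ⟨0, fun x hx hn => absurd ⟨x, hx, hn⟩ hs⟩
  choose Df hDf using hD0
  obtain ⟨D, hD⟩ := (hfin.image Df).bddAbove
  have bal : ∀ x, good x → ∀ j < M, ∀ l < M, tc j x ≤ tc l x + D := by
    intro x hx j hj l hl
    obtain ⟨hx1, w, hx2⟩ := id hx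
    have h1 := hDf (nts x) x hx rfl j hj l hl
    have h2 : Df (nts x) ≤ D := hD ⟨nts x, ⟨index_bound hf hx2, hV x hx1⟩, rfl⟩
    omega
  refine ⟨D + k * R + 2, fun w hw => ?_⟩
  obtain ⟨hs, hlt, hb⟩ := hL w hw
  by_cases h0 : ∃ j < M, j ∉ w
  · obtain ⟨j, hj, hjw⟩ := h0
    have := hb 0 (by omega) j hj
    rw [List.count_eq_zero_of_not_mem hjw] at this
    omega
  push Not at h0
  have hder : Relation.ReflTransGen (G.ModeStep f) [Sum.inl G.start] (w.map Sum.inr) :=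
    Relation.TransGen.to_reflTransGen hw
  obtain ⟨c, x, h1, h2, h3, h4, h5⟩ := exists_crossing (p := fun x => ∀ j < M, 0 < tc j x) hder
    (by
      intro h
      have := h 0 (by omega)
      simp [tc] at this)
    (by
      intro j hj
      rw [tc_map_inr]
      exact List.count_pos_iff.2 (h0 j hj))
  have gc : good c := ⟨h1, w, h3.head h2⟩
  have gx : good x := ⟨h1.tail h2, w, h3⟩
  have hsub := Sub.deriv h3
  obtain ⟨B, hB, hB'⟩ := hsub.bad 0 hs (by simp) (fun a ha _ => (tc_pos a x).1 (h5 a (hlt a ha)))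
  have hlen := index_bound hf h3
  obtain ⟨j, hj, hjB⟩ : ∃ j ∈ Finset.range M, j ∉ B := by
    apply Finset.exists_mem_notMem_of_card_lt_card
    rw [Finset.card_range]
    omega
  rw [Finset.mem_range] at hj
  have e1 := hB' j hjB
  push Not at h4
  obtain ⟨l, hl, hl0⟩ := h4
  have e2 := bal c gc j hj l hl
  obtain ⟨i, m, hm, hok⟩ := h2
  have e3 := steps_tc (hR i) m hm j
  have e4 : m * R ≤ k * R := Nat.mul_le_mul_right R (hf _ _ _ hok).1
  have e5 := hb 0 (by omega) j hj
  omega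

/-! The generating systems. -/

def mk (A : ℕ) (z : SForm ℕ) (Q : List ℕ) : List (Rule ℕ) :=
  (A, [Sum.inl A]) :: (A, z) :: Q.map (fun B => (B, [Sum.inl B]))

theorem mem_mk {A : ℕ} {z : SForm ℕ} {Q : List ℕ} {r : Rule ℕ} :
    r ∈ mk A z Q ↔ r = (A, [Sum.inl A]) ∨ r = (A, z) ∨ ∃ B ∈ Q, r = (B, [Sum.inl B]) := by
  simp [mk, eq_comm]

def sb (A : ℕ) (z x : SForm ℕ) : SForm ℕ :=
  x.flatMap (Sum.elim (fun B => if B = A then z else [Sum.inl B]) (fun a => [Sum.inr a]))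

theorem sb_append (A : ℕ) (z x y : SForm ℕ) : sb A z (x ++ y) = sb A z x ++ sb A z y := by
  simp [sb]

theorem sb_inl (A B : ℕ) (z x : SForm ℕ) :
    sb A z (Sum.inl B :: x) = (if B = A then z else [Sum.inl B]) ++ sb A z x := by
  simp [sb]

theorem sb_inr (A a : ℕ) (z x : SForm ℕ) :
    sb A z (Sum.inr a :: x) = Sum.inr a :: sb A z x := by
  simp [sb]

theorem sb_self (A : ℕ) (z x : SForm ℕ) (h : Sum.inl A ∉ x) : sb A z x = x := by
  induction x with
  | nil => rfl
  | cons a x ih =>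
    simp only [List.mem_cons, not_or] at h
    cases a with
    | inl B =>
      rw [sb_inl, ih h.2, if_neg]
      · rfl
      · rintro rfl; exact h.1 rfl
    | inr a => rw [sb_inr, ih h.2]

theorem mk_effect {A : ℕ} {z : SForm ℕ} {Q : List ℕ} {m : ℕ} {x y : SForm ℕ}
    (h : StepsN (mk A z Q) m x y) (hn : ¬ ∃ y', RStep (mk A z Q) y y') (hz : Sum.inl A ∉ z)
    (hQ : A ∉ Q) : y = sb A z x ∧ ∀ B ∈ Q, Sum.inl B ∉ x := by
  constructor
  · have h1 : sb A z x = sb A z y := by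
      refine steps_prop (fun x y => sb A z x = sb A z y) (fun _ => rfl) ?_ m h
      rintro x y w ⟨r, hr, u, v, rfl, rfl⟩ e
      rw [← e]
      rcases mem_mk.1 hr with rfl | rfl | ⟨B, hB, rfl⟩
      · simp
      · simp [sb_append, sb_inl, sb_self A z z hz]
      · simp
    rw [h1, sb_self]
    intro hA
    exact no_step hn hA (A, z) (mem_mk.2 (Or.inr (Or.inl rfl))) rfl
  · intro B hB hBx
    have hBA : B ≠ A := by rintro rfl; exact hQ hB
    have h1 : Sum.inl B ∈ y := by
      refine steps_prop (fun x y => Sum.inl B ∈ x → Sum.inl B ∈ y) (fun _ h => h) ?_ m h hBx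
      rintro x y w ⟨r, hr, u, v, rfl, rfl⟩ e hx
      apply e
      rcases mem_mk.1 hr with rfl | rfl | ⟨B, hB, rfl⟩
      · simpa using hx
      · simp [hBA] at hx
        simp; tauto
      · simpa using hx
    exact no_step hn h1 (B, [Sum.inl B]) (mem_mk.2 (Or.inr (Or.inr ⟨B, hB, rfl⟩))) rfl

def tl (j s : ℕ) : SForm ℕ := if s < 4 then [Sum.inl (4 * j + s + 1)] else []

def frm (M : ℕ) (c s : ℕ → ℕ) : SForm ℕ :=
  (List.range M).flatMap (fun j => List.replicate (c j) (Sum.inr j) ++ tl j (s j))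

theorem mem_tl {j s B : ℕ} : Sum.inl B ∈ tl j s ↔ s < 4 ∧ B = 4 * j + s + 1 := by
  unfold tl
  split_ifs with h <;> simp [h]

theorem mem_frm {M : ℕ} {c s : ℕ → ℕ} {B : ℕ} :
    Sum.inl B ∈ frm M c s ↔ ∃ j < M, s j < 4 ∧ B = 4 * j + s j + 1 := by
  simp [frm, mem_tl, List.mem_replicate]

theorem mem_frm' {M : ℕ} {c s : ℕ → ℕ} {j p : ℕ} (hp : p < 4) :
    Sum.inl (4 * j + p + 1) ∈ frm M c s ↔ j < M ∧ s j = p := by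
  rw [mem_frm]
  constructor
  · rintro ⟨l, hl, h1, h2⟩
    obtain rfl : l = j := by omega
    exact ⟨hl, by omega⟩
  · rintro ⟨h1, rfl⟩
    exact ⟨j, h1, hp, rfl⟩

theorem frm_congr {M : ℕ} {c s c' s' : ℕ → ℕ} (h : ∀ l < M, c l = c' l ∧ s l = s' l) :
    frm M c s = frm M c' s' := by
  unfold frm
  rw [List.flatMap_def, List.flatMap_def]
  congr 1
  apply List.map_congr_left
  intro l hl
  rw [(h l (List.mem_range.1 hl)).1, (h l (List.mem_range.1 hl)).2]

theorem sb_replicate (A : ℕ) (z : SForm ℕ) (n a : ℕ) :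
    sb A z (List.replicate n (Sum.inr a)) = List.replicate n (Sum.inr a) := by
  apply sb_self; simp [List.mem_replicate]

theorem sb_frm (M : ℕ) (c s : ℕ → ℕ) (j p e q : ℕ) (hp : p < 4) :
    sb (4 * j + p + 1) (List.replicate e (Sum.inr j) ++ tl j q) (frm M c s) =
      frm M (fun l => if l = j ∧ s l = p then c l + e else c l)
        (fun l => if l = j ∧ s l = p then q else s l) := by
  induction M with
  | zero => rfl
  | succ M ih =>
    have hfr : ∀ c s, frm (M + 1) c s =
        frm M c s ++ (List.replicate (c M) (Sum.inr M) ++ tl M (s M)) := by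
      intro c s; simp [frm, List.range_succ]
    rw [hfr, hfr, sb_append, ih, sb_append, sb_replicate]
    congr 1
    by_cases h : M = j ∧ s M = p
    · obtain ⟨rfl, rfl⟩ := h
      have e1 : sb (4 * M + s M + 1) (List.replicate e (Sum.inr M) ++ tl M q) (tl M (s M)) =
          List.replicate e (Sum.inr M) ++ tl M q := by
        have : tl M (s M) = [Sum.inl (4 * M + s M + 1)] := by simp [tl, hp]
        rw [this, sb_inl, if_pos rfl]
        simp [sb]
      rw [e1]
      simp only [and_self, if_true, List.replicate_add, List.append_assoc]
    · simp only [if_neg h]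
      rw [sb_self]
      rw [mem_tl]
      rintro ⟨h1, h2⟩
      exact h (by omega)

def mv (j p e q : ℕ) (Q : List ℕ) : List (Rule ℕ) :=
  mk (4 * j + p + 1) (List.replicate e (Sum.inr j) ++ tl j q) Q

def growQ (M p : ℕ) : List ℕ :=
  (List.range M).flatMap fun l => [4 * l + (p + 2) % 3 + 1, 4 * l + 3 + 1]

def finQ (M : ℕ) : List ℕ :=
  (List.range M).flatMap fun l => [4 * l + 0 + 1, 4 * l + 1 + 1, 4 * l + 2 + 1]

theorem mem_growQ {M p B : ℕ} : B ∈ growQ M p ↔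
    ∃ l < M, B = 4 * l + (p + 2) % 3 + 1 ∨ B = 4 * l + 3 + 1 := by
  simp [growQ]

theorem mem_finQ {M B : ℕ} : B ∈ finQ M ↔
    ∃ l < M, B = 4 * l + 0 + 1 ∨ B = 4 * l + 1 + 1 ∨ B = 4 * l + 2 + 1 := by
  simp [finQ]

def comps (M : ℕ) : List (List (Rule ℕ)) :=
  mk 0 (frm M (fun _ => 0) (fun _ => 0)) [] ::
    (List.range M).flatMap fun j => mv j 3 1 4 (finQ M) ::
      (List.range 3).flatMap fun p => [mv j p 1 ((p + 1) % 3) (growQ M p), mv j p 0 3 []]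

theorem mem_comps {M : ℕ} {P : List (Rule ℕ)} : P ∈ comps M ↔
    P = mk 0 (frm M (fun _ => 0) (fun _ => 0)) [] ∨
    ∃ j < M, P = mv j 3 1 4 (finQ M) ∨
      ∃ p < 3, P = mv j p 1 ((p + 1) % 3) (growQ M p) ∨ P = mv j p 0 3 [] := by
  simp only [comps, List.mem_cons, List.mem_flatMap, List.mem_range, List.not_mem_nil, or_false]

def gen (M : ℕ) : CDGS ℕ where
  deg := (comps M).length
  start := 0
  comp := fun i => (comps M).get i

theorem gen_comp_mem (M : ℕ) (i : Fin (gen M).deg) : (gen M).comp i ∈ comps M :=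
  List.get_mem _ _

theorem gen_comp_exists (M : ℕ) {P : List (Rule ℕ)} (h : P ∈ comps M) :
    ∃ i : Fin (gen M).deg, (gen M).comp i = P :=
  List.get_of_mem h

theorem gen_lamFree (M : ℕ) (hM : 0 < M) : (gen M).LamFree := by
  have hmk : ∀ A z Q, z ≠ [] → ∀ r ∈ mk A z Q, r.2 ≠ [] := by
    intro A z Q hz r hr
    rcases mem_mk.1 hr with rfl | rfl | ⟨B, hB, rfl⟩
    · simp
    · exact hz
    · simp
  intro i
  rcases mem_comps.1 (gen_comp_mem M i) with h | ⟨j, hj, h | ⟨p, hp, h | h⟩⟩ <;> rw [h]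
  · apply hmk
    intro h
    have : Sum.inl (4 * 0 + 0 + 1) ∈ frm M (fun _ => 0) (fun _ => 0) :=
      (mem_frm' (by omega)).2 ⟨hM, rfl⟩
    rw [h] at this
    simp at this
  · apply hmk; simp
  · apply hmk; simp
  · apply hmk; simp [tl]

def Inv (M : ℕ) (c s : ℕ → ℕ) : Prop :=
  (∃ b, ∀ j < M, b ≤ c j ∧ c j ≤ b + 1 ∧ (s j = c j % 3 ∨ s j = 3)) ∨
  (∃ b, ∀ j < M, (s j = 3 ∧ b ≤ c j ∧ c j ≤ b + 1) ∨ (s j = 4 ∧ b ≤ c j ∧ c j ≤ b + 2))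

theorem mv_effect {M : ℕ} {c s : ℕ → ℕ} {j p e q : ℕ} {Q : List ℕ} {m : ℕ} {y : SForm ℕ}
    (hp : p < 4) (hq : q ≠ p) (hQ : 4 * j + p + 1 ∉ Q) (h : StepsN (mv j p e q Q) m (frm M c s) y)
    (hn : ¬ ∃ y', RStep (mv j p e q Q) y y') :
    y = frm M (fun l => if l = j ∧ s l = p then c l + e else c l)
        (fun l => if l = j ∧ s l = p then q else s l) ∧ ∀ B ∈ Q, Sum.inl B ∉ frm M c s := by
  rw [← sb_frm M c s j p e q hp]
  refine mk_effect h hn ?_ hQ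
  simp only [List.mem_append, List.mem_replicate, mem_tl]
  rintro (h | h)
  · simp at h
  · omega

theorem inv_fin {M : ℕ} {c s : ℕ → ℕ} {j : ℕ} (h : Inv M c s)
    (hQ : ∀ l < M, s l ≠ 0 ∧ s l ≠ 1 ∧ s l ≠ 2) :
    Inv M (fun l => if l = j ∧ s l = 3 then c l + 1 else c l)
      (fun l => if l = j ∧ s l = 3 then 4 else s l) := by
  right
  rcases h with ⟨b, h⟩ | ⟨b, h⟩ <;> refine ⟨b, fun l hl => ?_⟩ <;>
    have h1 := h l hl <;> have h2 := hQ l hl <;> dsimp only <;> split_ifs <;> omega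

theorem inv_toF {M : ℕ} {c s : ℕ → ℕ} {j p : ℕ} (hp : p < 3) (h : Inv M c s) :
    Inv M (fun l => if l = j ∧ s l = p then c l + 0 else c l)
      (fun l => if l = j ∧ s l = p then 3 else s l) := by
  rcases h with ⟨b, h⟩ | ⟨b, h⟩
  · left
    refine ⟨b, fun l hl => ?_⟩
    have h1 := h l hl
    dsimp only
    split_ifs <;> omega
  · right
    refine ⟨b, fun l hl => ?_⟩
    have h1 := h l hl
    dsimp only
    split_ifs <;> omega

theorem inv_grow {M : ℕ} {c s : ℕ → ℕ} {j p : ℕ} (hj : j < M) (hp : p < 3) (h : Inv M c s)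
    (hQ : ∀ l < M, s l ≠ (p + 2) % 3 ∧ s l ≠ 3) :
    Inv M (fun l => if l = j ∧ s l = p then c l + 1 else c l)
      (fun l => if l = j ∧ s l = p then (p + 1) % 3 else s l) := by
  rcases h with ⟨b, h⟩ | ⟨b, h⟩
  · left
    have hj1 := h j hj
    have hj2 := hQ j hj
    by_cases hsj : s j = p
    · by_cases hcj : c j = b
      · refine ⟨b, fun l hl => ?_⟩
        have h1 := h l hl
        have h2 := hQ l hl
        dsimp only
        split_ifs with h3
        · obtain ⟨rfl, h3⟩ := h3
          omega
        · omega
      · refine ⟨b + 1, fun l hl => ?_⟩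
        have h1 := h l hl
        have h2 := hQ l hl
        dsimp only
        split_ifs with h3
        · obtain ⟨rfl, h3⟩ := h3
          omega
        · omega
    · refine ⟨b, fun l hl => ?_⟩
      have h1 := h l hl
      dsimp only
      split_ifs with h3
      · obtain ⟨rfl, h3⟩ := h3
        omega
      · omega
  · right
    refine ⟨b, fun l hl => ?_⟩
    have h1 := h l hl
    dsimp only
    split_ifs <;> omega

theorem gen_reach {M : ℕ} {f : Mode} 
    (hf : ∀ (P : List (Rule ℕ)) m y, modeOK P f m y → ¬ ∃ z, RStep P y z) {x : SForm ℕ}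
    (h : Relation.ReflTransGen ((gen M).ModeStep f) [Sum.inl 0] x) :
    x = [Sum.inl 0] ∨ ∃ c s, x = frm M c s ∧ Inv M c s := by
  induction h with
  | refl => exact Or.inl rfl
  | @tail x y _ hs ih =>
    obtain ⟨i, m, hm, hok⟩ := hs
    have hn := hf _ _ _ hok
    rcases ih with rfl | ⟨c, s, rfl, hI⟩
    · rcases mem_comps.1 (gen_comp_mem M i) with h | ⟨j, hj, h⟩
      · rw [h] at hm hn
        right
        refine ⟨fun _ => 0, fun _ => 0, ?_, Or.inl ⟨0, by simp⟩⟩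
        have := (mk_effect hm hn (by simp [mem_frm]) (by simp)).1
        rw [this, sb_inl]
        simp [sb]
      · left
        have hne : ∀ r ∈ (gen M).comp i, r.1 ≠ 0 := by
          have : ∀ j p e q Q, 0 ∉ Q → ∀ r ∈ mv j p e q Q, r.1 ≠ 0 := by
            intro j p e q Q hQ r hr
            rcases mem_mk.1 hr with rfl | rfl | ⟨B, hB, rfl⟩
            · simp
            · simp
            · dsimp only; rintro rfl; exact hQ hB
          rcases h with h | ⟨p, hp, h | h⟩ <;> rw [h] <;> apply this
          · rw [mem_finQ]; rintro ⟨l, hl, h⟩; omega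
          · rw [mem_growQ]; rintro ⟨l, hl, h⟩; omega
          · simp
        refine steps_prop (P := (gen M).comp i)
          (fun x y => x = [Sum.inl 0] → y = [Sum.inl 0]) (fun _ h => h) ?_ m hm rfl
        rintro x y z ⟨r, hr, u, v, h1, h2⟩ _ h3
        exfalso
        have : Sum.inl r.1 ∈ x := by rw [h1]; simp
        rw [h3] at this
        simp at this
        exact hne r hr this
    · right
      rcases mem_comps.1 (gen_comp_mem M i) with h | ⟨j, hj, h | ⟨p, hp, h | h⟩⟩ <;>
        rw [h] at hm hn
      · have := (mk_effect hm hn (by simp [mem_frm]) (by simp)).1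
        rw [sb_self _ _ _ (by simp [mem_frm])] at this
        exact ⟨c, s, this, hI⟩
      · obtain ⟨h1, h2⟩ := mv_effect (by omega) (by omega)
          (by rw [mem_finQ]; rintro ⟨l, hl, h⟩; omega) hm hn
        refine ⟨_, _, h1, inv_fin hI fun l hl => ?_⟩
        have a0 := h2 _ (mem_finQ.2 ⟨l, hl, Or.inl rfl⟩)
        have a1 := h2 _ (mem_finQ.2 ⟨l, hl, Or.inr (Or.inl rfl)⟩)
        have a2 := h2 _ (mem_finQ.2 ⟨l, hl, Or.inr (Or.inr rfl)⟩)
        rw [mem_frm' (j := l) (p := 0) (by omega)] at a0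
        rw [mem_frm' (by omega)] at a1 a2
        exact ⟨fun e => a0 ⟨hl, e⟩, fun e => a1 ⟨hl, e⟩, fun e => a2 ⟨hl, e⟩⟩
      · obtain ⟨h1, h2⟩ := mv_effect (by omega) (by omega)
          (by rw [mem_growQ]; rintro ⟨l, hl, h⟩; omega) hm hn
        refine ⟨_, _, h1, inv_grow hj hp hI fun l hl => ?_⟩
        have a0 := h2 _ (mem_growQ.2 ⟨l, hl, Or.inl rfl⟩)
        have a1 := h2 _ (mem_growQ.2 ⟨l, hl, Or.inr rfl⟩)
        rw [mem_frm' (by omega)] at a0 a1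
        exact ⟨fun e => a0 ⟨hl, e⟩, fun e => a1 ⟨hl, e⟩⟩
      · obtain ⟨h1, h2⟩ := mv_effect (by omega) (by omega) (by simp) hm hn
        exact ⟨_, _, h1, inv_toF hp hI⟩

def wd (M : ℕ) (c : ℕ → ℕ) : List ℕ := (List.range M).flatMap fun j => List.replicate (c j) j

theorem frm_eq_wd {M : ℕ} {c s : ℕ → ℕ} (h : ∀ j < M, ¬ s j < 4) :
    frm M c s = (wd M c).map Sum.inr := by
  unfold frm wd
  rw [List.map_flatMap, List.flatMap_def, List.flatMap_def]
  congr 1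
  apply List.map_congr_left
  intro l hl
  simp [tl, h l (List.mem_range.1 hl)]

theorem mem_wd {M : ℕ} {c : ℕ → ℕ} {a : ℕ} (h : a ∈ wd M c) : a < M := by
  simp only [wd, List.mem_flatMap, List.mem_range, List.mem_replicate] at h
  obtain ⟨j, hj, -, rfl⟩ := h
  exact hj

theorem wd_succ (M : ℕ) (c : ℕ → ℕ) : wd (M + 1) c = wd M c ++ List.replicate (c M) M := by
  simp [wd, List.range_succ]

theorem wd_sorted (M : ℕ) (c : ℕ → ℕ) : (wd M c).Pairwise (· ≤ ·) := by
  induction M with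
  | zero => simp [wd]
  | succ M ih =>
    rw [wd_succ, List.pairwise_append]
    refine ⟨ih, ?_, ?_⟩
    · simp [List.pairwise_replicate]
    · intro a ha b hb
      have := mem_wd ha
      have := (List.mem_replicate.1 hb).2
      omega

theorem wd_count {M : ℕ} {c : ℕ → ℕ} {j : ℕ} (hj : j < M) : (wd M c).count j = c j := by
  induction M with
  | zero => omega
  | succ M ih =>
    rw [wd_succ, List.count_append, List.count_replicate]
    by_cases h : j = M
    · subst h
      rw [List.count_eq_zero_of_not_mem (fun h => by have := mem_wd h; omega)]
      simp
    · rw [ih (by omega)]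
      simp; omega

theorem gen_bal {M : ℕ} {f : Mode} 
    (hf : ∀ (P : List (Rule ℕ)) m y, modeOK P f m y → ¬ ∃ z, RStep P y z) {w : List ℕ}
    (h : w ∈ (gen M).lang f) : Bal M w := by
  have h' : Relation.ReflTransGen ((gen M).ModeStep f) [Sum.inl 0] (w.map Sum.inr) :=
    Relation.TransGen.to_reflTransGen h
  rcases gen_reach hf h' with h1 | ⟨c, s, h1, hI⟩
  · have := nts_map_inr w
    rw [h1] at this
    simp [nts_inl] at this
  · have h4 : ∀ j < M, ¬ s j < 4 := by
      intro j hj hs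
      have : Sum.inl (4 * j + s j + 1) ∈ frm M c s := (mem_frm' hs).2 ⟨hj, rfl⟩
      rw [← h1] at this
      simp at this
    rw [frm_eq_wd h4] at h1
    obtain rfl : w = wd M c := List.map_injective_iff.2 Sum.inr_injective h1
    refine ⟨wd_sorted M c, fun a ha => mem_wd ha, fun j hj l hl => ?_⟩
    rw [wd_count hj, wd_count hl]
    have := h4 j hj
    have := h4 l hl
    rcases hI with ⟨b, hI⟩ | ⟨b, hI⟩ <;> have := hI j hj <;> have := hI l hl <;> omega

theorem mk_run {A : ℕ} {z : SForm ℕ} {Q : List ℕ} (k : ℕ) (hk : 1 ≤ k) (u v : SForm ℕ) :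
    StepsN (mk A z Q) k (u ++ Sum.inl A :: v) (u ++ z ++ v) := by
  induction k, hk using Nat.le_induction with
  | base => exact ⟨_, ⟨(A, z), mem_mk.2 (Or.inr (Or.inl rfl)), u, v, rfl, rfl⟩, rfl⟩
  | succ k _ ih =>
    exact ⟨_, ⟨(A, [Sum.inl A]), mem_mk.2 (Or.inl rfl), u, v, rfl, rfl⟩, by simpa using ih⟩

theorem mk_final {A : ℕ} {z : SForm ℕ} {Q : List ℕ} {y : SForm ℕ} (hA : Sum.inl A ∉ y)
    (hQ : ∀ B ∈ Q, Sum.inl B ∉ y) : ¬ ∃ y', RStep (mk A z Q) y y' := by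
  rintro ⟨y', r, hr, u, v, rfl, rfl⟩
  rcases mem_mk.1 hr with rfl | rfl | ⟨B, hB, rfl⟩
  · exact hA (by simp)
  · exact hA (by simp)
  · exact hQ B hB (by simp)

theorem mv_step {M k : ℕ} (hk : 1 ≤ k) {f : Mode}
    (hf : ∀ (P : List (Rule ℕ)) y, (¬ ∃ z, RStep P y z) → modeOK P f k y)
    {c s c' s' : ℕ → ℕ} (j p e q : ℕ) (Q : List ℕ)
    (hmem : mv j p e q Q ∈ comps M) (hj : j < M) (hp : p < 4) (hq : q ≠ p) (hs : s j = p)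
    (h1 : c' j = c j + e) (h2 : s' j = q) (h3 : ∀ l < M, l ≠ j → c' l = c l ∧ s' l = s l)
    (hQ : ∀ B ∈ Q, Sum.inl B ∉ frm M c' s') :
    (gen M).ModeStep f (frm M c s) (frm M c' s') := by
  obtain ⟨i, hi⟩ := gen_comp_exists M hmem
  refine ⟨i, k, ?_, hf _ _ ?_⟩ <;> rw [hi]
  · obtain ⟨l1, l2, hl⟩ := List.append_of_mem (List.mem_range.2 hj)
    have hnd := List.nodup_range (n := M)
    rw [hl] at hnd
    have hnd1 : j ∉ l1 := by
      intro hj1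
      rw [List.nodup_append] at hnd
      exact hnd.2.2 j hj1 j (by simp) rfl
    have hnd2 : j ∉ l2 := by
      rw [List.nodup_append] at hnd
      exact (List.nodup_cons.1 hnd.2.1).1
    have key : ∀ l' : List ℕ, (∀ l ∈ l', l ∈ List.range M) → j ∉ l' →
        l'.flatMap (fun j => List.replicate (c' j) (Sum.inr j) ++ tl j (s' j)) =
        l'.flatMap (fun j => List.replicate (c j) (Sum.inr j) ++ tl j (s j)) := by
      intro l' hl' hjl
      rw [List.flatMap_def, List.flatMap_def]
      congr 1
      apply List.map_congr_left
      intro l hll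
      obtain ⟨e1, e2⟩ := h3 l (List.mem_range.1 (hl' l hll)) (by rintro rfl; exact hjl hll)
      rw [e1, e2]
    have k1 := key l1 (by intro l h; rw [hl]; simp [h]) hnd1
    have k2 := key l2 (by intro l h; rw [hl]; simp [h]) hnd2
    have run := mk_run (A := 4 * j + p + 1) (z := List.replicate e (Sum.inr j) ++ tl j q) (Q := Q)
      k hk (l1.flatMap (fun j => List.replicate (c j) (Sum.inr j) ++ tl j (s j)) ++
        List.replicate (c j) (Sum.inr j))
      (l2.flatMap (fun j => List.replicate (c j) (Sum.inr j) ++ tl j (s j)))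
    have tls : tl j p = [Sum.inl (4 * j + p + 1)] := by simp [tl, hp]
    unfold mv
    convert run using 1
    · rw [frm, hl, List.flatMap_append, List.flatMap_cons, hs, tls]
      simp
    · rw [frm, hl, List.flatMap_append, List.flatMap_cons, k1, k2, h1, h2]
      simp only [List.replicate_add, List.append_assoc]
  · exact mk_final (by rw [mem_frm' hp]; rintro ⟨-, e⟩; omega) hQ

theorem sweep {α : Type*} {r : α → α → Prop} (F : ℕ → α) (M : ℕ)
    (h : ∀ t < M, r (F t) (F (t + 1))) : Relation.ReflTransGen r (F 0) (F M) := by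
  induction M with
  | zero => exact .refl
  | succ M ih => exact (ih (fun t ht => h t (by omega))).tail (h M (by omega))

theorem gen_unbounded {M k : ℕ} (hM : 0 < M) (hk : 1 ≤ k) {f : Mode}
    (hf : ∀ (P : List (Rule ℕ)) y, (¬ ∃ z, RStep P y z) → modeOK P f k y) (n : ℕ) :
    wd M (fun _ => n + 1) ∈ (gen M).lang f := by
  have hstart : Relation.TransGen ((gen M).ModeStep f) [Sum.inl 0]
      (frm M (fun _ => 0) (fun _ => 0)) := by
    obtain ⟨i, hi⟩ := gen_comp_exists M (mem_comps.2 (Or.inl rfl))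
    refine .single ⟨i, k, ?_, hf _ _ ?_⟩ <;> rw [hi]
    · simpa using mk_run (A := 0) (z := frm M (fun _ => 0) (fun _ => 0)) (Q := []) k hk [] []
    · exact mk_final (by simp [mem_frm]) (by simp)
  have hgrow : ∀ i, Relation.ReflTransGen ((gen M).ModeStep f)
      (frm M (fun _ => i) (fun _ => i % 3)) (frm M (fun _ => i + 1) (fun _ => (i + 1) % 3)) := by
    intro i
    have := sweep (r := (gen M).ModeStep f) (fun t => frm M (fun l => if l < t then i + 1 else i)
      (fun l => if l < t then (i + 1) % 3 else i % 3)) M (by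
        intro t ht
        refine mv_step hk hf t (i % 3) 1 ((i % 3 + 1) % 3) (growQ M (i % 3))
          (mem_comps.2 (Or.inr ⟨t, ht, Or.inr ⟨i % 3, by omega, Or.inl rfl⟩⟩)) ht (by omega)
          (by omega) (by simp) (by simp) (by simp) ?_ ?_
        · intro l hl hlt
          have : l < t + 1 ↔ l < t := by omega
          simp [this]
        · intro B hB
          rw [mem_growQ] at hB
          obtain ⟨l, hl, rfl | rfl⟩ := hB <;> rw [mem_frm' (by omega)] <;> rintro ⟨-, e⟩ <;>
            split_ifs at e <;> omega)
    have e1 : frm M (fun l => if l < M then i + 1 else i)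
      (fun l => if l < M then (i + 1) % 3 else i % 3) =
        frm M (fun _ => i + 1) (fun _ => (i + 1) % 3) :=
      frm_congr (fun l hl => by simp [hl])
    simpa only [Nat.not_lt_zero, if_false, e1] using this
  have hall : ∀ i, Relation.ReflTransGen ((gen M).ModeStep f)
      (frm M (fun _ => 0) (fun _ => 0)) (frm M (fun _ => i) (fun _ => i % 3)) := by
    intro i
    induction i with
    | zero => exact .refl
    | succ i ih => exact ih.trans (hgrow i)
  have htoF : Relation.ReflTransGen ((gen M).ModeStep f)
      (frm M (fun _ => n) (fun _ => n % 3)) (frm M (fun _ => n) (fun _ => 3)) := by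
    have := sweep (r := (gen M).ModeStep f) (fun t => frm M (fun _ => n)
      (fun l => if l < t then 3 else n % 3)) M (by
        intro t ht
        refine mv_step hk hf t (n % 3) 0 3 []
          (mem_comps.2 (Or.inr ⟨t, ht, Or.inr ⟨n % 3, by omega, Or.inr rfl⟩⟩)) ht (by omega)
          (by omega) (by simp) (by simp) (by simp) ?_ (by simp)
        intro l hl hlt
        have : l < t + 1 ↔ l < t := by omega
        simp [this])
    have e1 : frm M (fun _ => n) (fun l => if l < M then 3 else n % 3) =
        frm M (fun _ => n) (fun _ => 3) :=
      frm_congr (fun l hl => by simp [hl])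
    simpa only [Nat.not_lt_zero, if_false, e1] using this
  have hfin : Relation.ReflTransGen ((gen M).ModeStep f)
      (frm M (fun _ => n) (fun _ => 3)) (frm M (fun _ => n + 1) (fun _ => 4)) := by
    have := sweep (r := (gen M).ModeStep f) (fun t => frm M (fun l => if l < t then n + 1 else n)
      (fun l => if l < t then 4 else 3)) M (by
        intro t ht
        refine mv_step hk hf t 3 1 4 (finQ M)
          (mem_comps.2 (Or.inr ⟨t, ht, Or.inl rfl⟩)) ht (by omega)
          (by omega) (by simp) (by simp) (by simp) ?_ ?_
        · intro l hl hlt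
          have : l < t + 1 ↔ l < t := by omega
          simp [this]
        · intro B hB
          rw [mem_finQ] at hB
          obtain ⟨l, hl, rfl | rfl | rfl⟩ := hB
          · rw [mem_frm' (j := l) (p := 0) (by omega)]
            rintro ⟨-, e⟩
            split_ifs at e
          · rw [mem_frm' (by omega)]
            rintro ⟨-, e⟩
            split_ifs at e <;> omega
          · rw [mem_frm' (by omega)]
            rintro ⟨-, e⟩
            split_ifs at e <;> omega)
    have e1 : frm M (fun l => if l < M then n + 1 else n) (fun l => if l < M then 4 else 3) =
        frm M (fun _ => n + 1) (fun _ => 4) :=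
      frm_congr (fun l hl => by simp [hl])
    simpa only [Nat.not_lt_zero, if_false, e1] using this
  have := hstart.trans_left ((hall n).trans (htoF.trans hfin))
  rw [frm_eq_wd (by simp)] at this
  exact this

/-- Let Δ ∈ {≤, =} and k ∈ ℕ (positive) be fixed. The hierarchy of
the families L_n := L(CD_n, CF[−λ], (t∧Δk)) with respect to the number n of
components is infinite: for every n there is m > n with L_n ⊊ L_m; with and
without erasing rules. -/
theorem stmt10 (lf : Bool) (d : ℕ → Mode) (hd : d = Mode.le ∨ d = Mode.eq)
    (k : ℕ) (hk : 1 ≤ k) :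
    ∀ n : ℕ, 1 ≤ n → ∃ m : ℕ, n < m ∧
      CDFam ℕ lf n (Mode.conj Mode.t (d k)) ⊂ CDFam ℕ lf m (Mode.conj Mode.t (d k)) := by
  intro n _
  have hf1 : ∀ (P : List (Rule ℕ)) m y, modeOK P (Mode.conj Mode.t (d k)) m y →
      m ≤ k ∧ ¬ ∃ z, RStep P y z := by
    rintro P m y ⟨h1, h2⟩
    rcases hd with rfl | rfl
    · exact ⟨h2, h1⟩
    · exact ⟨le_of_eq h2, h1⟩
  have hf2 : ∀ (P : List (Rule ℕ)) y, (¬ ∃ z, RStep P y z) →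
      modeOK P (Mode.conj Mode.t (d k)) k y := by
    intro P y h
    rcases hd with rfl | rfl
    · exact ⟨h, le_refl k⟩
    · exact ⟨h, rfl⟩
  set f := Mode.conj Mode.t (d k)
  set M := 2 * (n * k) + 1 with hM
  refine ⟨max (n + 1) (gen M).deg, by omega, ?_, ?_⟩
  · rintro L ⟨G, h1, h2, h3⟩
    exact ⟨G, by omega, h2, h3⟩
  · intro hsub
    obtain ⟨G, h1, h2, h3⟩ := hsub (show (gen M).lang f ∈ _ from
      ⟨gen M, le_max_right _ _, fun _ => gen_lamFree M (by omega), rfl⟩)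
    have h4 : ∀ w : List ℕ, w ≠ [] → (w ∈ G.lang f ↔ w ∈ (gen M).lang f) := by
      intro w hw
      have : w ∈ G.lang f \ {[]} ↔ w ∈ (gen M).lang f \ {[]} := by rw [h3]
      simpa [hw] using this
    obtain ⟨C, hC⟩ := not_unbounded (G := G) (M := M) hf1
      (by have := Nat.mul_le_mul_right k h1; omega) (by
        intro w hw
        by_cases hw0 : w = []
        · subst hw0
          exact ⟨by simp, by simp, by simp⟩
        · exact gen_bal (fun P m y h => (hf1 P m y h).2) ((h4 w hw0).1 hw))
    have h5 := gen_unbounded (M := M) (by omega) hk hf2 C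
    have h6 : (wd M (fun _ => C + 1)).count 0 = C + 1 := wd_count (by omega)
    have h7 := hC _ ((h4 _ (by intro h; rw [h] at h6; simp at h6)).2 h5)
    omega

end CDHybrid
end

section
/- The language { aⁿbⁿaᵐbᵐ | n, m ≥ 1 } over {a,b} is not a linear context-free language, but it belongs to L(CD_3, CF−λ, (t∧=1)), i.e., it is generated by a CD grammar system with three λ-free context-free components working in the (t∧=1)-mode. -/
namespace CDHybrid

/-- The language { aⁿbⁿaᵐbᵐ | n, m ≥ 1 }, where a is encoded as 0 and b as 1. -/
def anbnambm : Set (List ℕ) :=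
  { w | ∃ n m : ℕ, 1 ≤ n ∧ 1 ≤ m ∧
      w = List.replicate n 0 ++ List.replicate n 1 ++
          List.replicate m 0 ++ List.replicate m 1 }

section Aux

/-! ### Linear part -/

inductive Gen (R : List (Rule ℕ)) : ℕ → List ℕ → Prop
  | term (A : ℕ) (y : List ℕ) : (A, y.map Sum.inr) ∈ R → Gen R A y
  | step (A B : ℕ) (p q x : List ℕ) :
      (A, p.map Sum.inr ++ Sum.inl B :: q.map Sum.inr) ∈ R → Gen R B x → Gen R A (p ++ x ++ q)

theorem lin_form (z : SForm ℕ) (h : ntCount z ≤ 1) :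
    (∃ y : List ℕ, z = y.map Sum.inr) ∨
    (∃ (p q : List ℕ) (B : ℕ), z = p.map Sum.inr ++ Sum.inl B :: q.map Sum.inr) := by
  induction z with
  | nil => exact Or.inl ⟨[], rfl⟩
  | cons c z ih =>
    rcases c with B | a
    · right
      have hz : ntCount z = 0 := by
        have h' : ntCount z + 1 ≤ 1 := h
        omega
      have h2 : ∃ y : List ℕ, z = y.map Sum.inr := by
        clear ih h
        induction z with
        | nil => exact ⟨[], rfl⟩
        | cons c z ih =>
          rcases c with C | a
          · simp [ntCount] at hz
          · obtain ⟨y, hy⟩ := ih (by simpa [ntCount] using hz)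
            exact ⟨a :: y, by simp [hy]⟩
      obtain ⟨y, hy⟩ := h2
      exact ⟨[], y, B, by simp [hy]⟩
    · rcases ih (by simpa [ntCount] using h) with ⟨y, hy⟩ | ⟨p, q, B, hy⟩
      · exact Or.inl ⟨a :: y, by simp [hy]⟩
      · exact Or.inr ⟨a :: p, q, B, by simp [hy]⟩

theorem uniq_nt (u v : List ℕ) (A B : ℕ) (p q : SForm ℕ)
    (h : u.map Sum.inr ++ Sum.inl A :: v.map Sum.inr = p ++ Sum.inl B :: q) :
    p = u.map Sum.inr ∧ A = B ∧ q = v.map Sum.inr := by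
  induction u generalizing p with
  | nil =>
    cases p with
    | nil => simp at h; simp [h]
    | cons c p =>
      simp at h
      have : (Sum.inl B : Symb ℕ) ∈ v.map Sum.inr := by rw [h.2]; simp
      simp at this
  | cons a u ih =>
    cases p with
    | nil => simp at h
    | cons c p =>
      simp at h
      obtain ⟨h1, h2⟩ := h
      obtain ⟨h3, h4, h5⟩ := ih p h2
      exact ⟨by simp [← h1, h3], h4, h5⟩

theorem gen_of_der (R : List (Rule ℕ)) (hR : ∀ r ∈ R, ntCount r.2 ≤ 1) (w : List ℕ) (s : SForm ℕ)
    (h : Relation.ReflTransGen (RStep R) s (w.map Sum.inr)) :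
    (∀ y : List ℕ, s = y.map Sum.inr → w = y) ∧
    ∀ (u v : List ℕ) (A : ℕ), s = u.map Sum.inr ++ Sum.inl A :: v.map Sum.inr →
      ∃ x, Gen R A x ∧ w = u ++ x ++ v := by
  induction h using Relation.ReflTransGen.head_induction_on with
  | refl =>
    constructor
    · intro y hy
      exact List.map_injective_iff.mpr Sum.inr_injective hy
    · intro u v A hs
      have : (Sum.inl A : Symb ℕ) ∈ w.map Sum.inr := by rw [hs]; simp
      simp at this
  | head hst _ ih =>
    obtain ⟨r, hr, p, q, h1, h2⟩ := hst
    constructor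
    · intro y hy
      have : (Sum.inl r.1 : Symb ℕ) ∈ y.map Sum.inr := by rw [← hy, h1]; simp
      simp at this
    · intro u v A hs
      obtain ⟨hp, hA, hq⟩ := uniq_nt u v A r.1 p q (hs.symm.trans h1)
      subst hp hA hq
      rcases lin_form r.2 (hR r hr) with ⟨y, hy⟩ | ⟨p, q, B, hy⟩
      · refine ⟨y, Gen.term _ _ (by rw [← hy]; exact hr), ?_⟩
        exact ih.1 (u ++ y ++ v) (by rw [h2, hy]; simp)
      · obtain ⟨x, hx, hw⟩ := ih.2 (u ++ p) (q ++ v) B (by rw [h2, hy]; simp)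
        exact ⟨p ++ x ++ q, Gen.step _ B p q x (by rw [← hy]; exact hr) hx, by simp [hw]⟩

theorem der_of_gen (R : List (Rule ℕ)) (A : ℕ) (x : List ℕ) (h : Gen R A x) :
    ∀ u v : List ℕ, Relation.ReflTransGen (RStep R)
      (u.map Sum.inr ++ Sum.inl A :: v.map Sum.inr) ((u ++ x ++ v).map Sum.inr) := by
  induction h with
  | term A y hy =>
    intro u v
    exact Relation.ReflTransGen.single ⟨_, hy, u.map Sum.inr, v.map Sum.inr, rfl, by simp⟩
  | step A B p q x hr _ ih =>
    intro u v
    refine Relation.ReflTransGen.head ⟨_, hr, u.map Sum.inr, v.map Sum.inr, rfl, rfl⟩ ?_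
    have := ih (u ++ p) (q ++ v)
    simpa using this

theorem lang_iff (G : CFG ℕ) (hG : G.Linear) (w : List ℕ) : w ∈ G.lang ↔ Gen G.rules G.start w := by
  constructor
  · intro h
    obtain ⟨x, hx, hw⟩ := (gen_of_der G.rules hG w _ h).2 [] [] G.start rfl
    simp at hw
    rw [hw]; exact hx
  · intro h
    have := der_of_gen _ _ _ h [] []
    simpa [CFG.lang] using this

theorem cut (R : List (Rule ℕ)) (S N K : ℕ) (hK : ∀ r ∈ R, r.2.length ≤ K) (A : ℕ) (x : List ℕ)
    (h : Gen R A x) : ∀ u v : List ℕ, u.length ≤ N → v.length ≤ N →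
      (∀ y, Gen R A y → Gen R S (u ++ y ++ v)) → 2 * N + K < (u ++ x ++ v).length →
      ∃ (u' v' x' : List ℕ) (B : ℕ), u' ++ x' ++ v' = u ++ x ++ v ∧ Gen R B x' ∧
        B ∈ R.map Prod.fst ∧
        (∀ y, Gen R B y → Gen R S (u' ++ y ++ v')) ∧ u'.length ≤ N + K ∧ v'.length ≤ N + K ∧
        (N < u'.length ∨ N < v'.length) := by
  induction h with
  | term A y hy =>
    intro u v hu hv _ hl
    have := hK _ hy
    simp at this hl
    omega
  | step A B p q x hr hx ih =>
    intro u v hu hv hC hl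
    have hlen := hK _ hr
    simp at hlen
    have hC' : ∀ y, Gen R B y → Gen R S ((u ++ p) ++ y ++ (q ++ v)) := by
      intro y hy
      have := hC _ (Gen.step A B p q y hr hy)
      simpa using this
    by_cases hc : (u ++ p).length ≤ N ∧ (q ++ v).length ≤ N
    · obtain ⟨u', v', x', B', h1, h2⟩ := ih (u ++ p) (q ++ v) hc.1 hc.2 hC' (by simpa using hl)
      exact ⟨u', v', x', B', by rw [h1]; simp, h2⟩
    · refine ⟨u ++ p, q ++ v, x, B, by simp, hx, ?_, hC', ?_, ?_, ?_⟩
      · cases hx with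
        | term _ _ h => exact List.mem_map_of_mem (f := Prod.fst) h
        | step _ _ _ _ _ h _ => exact List.mem_map_of_mem (f := Prod.fst) h
      · simp; omega
      · simp; omega
      · simp at hc ⊢; omega

theorem rep_cons (a b : ℕ) (hab : a ≠ b) (n k : ℕ) (s t : List ℕ)
    (h : List.replicate n a ++ b :: s = List.replicate k a ++ b :: t) : n = k ∧ s = t := by
  induction n generalizing k with
  | zero =>
    cases k with
    | zero => simpa using h
    | succ k => simp [List.replicate_succ] at h; exact absurd h.1.symm hab
  | succ n ih =>
    cases k with
    | zero => simp [List.replicate_succ] at h; exact absurd h.1 hab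
    | succ k =>
      simp [List.replicate_succ] at h
      have := ih k (by simpa using h)
      exact ⟨by omega, this.2⟩

theorem blocks (a b : ℕ) (hab : a ≠ b) (n p k m : ℕ) (hp : 1 ≤ p) (hk : 1 ≤ k) (hm : 1 ≤ m)
    (z s : List ℕ)
    (h : List.replicate n a ++ List.replicate p b ++ a :: z =
      List.replicate k a ++ List.replicate k b ++ List.replicate m a ++ s) : n = p := by
  obtain ⟨p, rfl⟩ := Nat.exists_eq_add_of_le' hp
  obtain ⟨k, rfl⟩ := Nat.exists_eq_add_of_le' hk
  obtain ⟨m, rfl⟩ := Nat.exists_eq_add_of_le' hm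
  simp only [List.replicate_succ (a := b), List.replicate_succ (n := m), List.append_assoc,
    List.cons_append] at h
  obtain ⟨h1, h2⟩ := rep_cons a b hab _ _ _ _ h
  obtain ⟨h3, h4⟩ := rep_cons b a hab.symm _ _ _ _ h2
  omega

theorem left_lang (n p : ℕ) (hp : 1 ≤ p) (z : List ℕ)
    (h : List.replicate n 0 ++ List.replicate p 1 ++ 0 :: z ∈ anbnambm) : n = p := by
  obtain ⟨k, m, hk, hm, h⟩ := h
  exact blocks 0 1 (by simp) n p k m hp hk hm z _ h

theorem right_lang (n p : ℕ) (hp : 1 ≤ p) (z : List ℕ)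
    (h : z ++ 1 :: (List.replicate p 0 ++ List.replicate n 1) ∈ anbnambm) : n = p := by
  obtain ⟨k, m, hk, hm, h⟩ := h
  have h := congrArg List.reverse h
  refine blocks 1 0 (by simp) n p m k hp hm hk z.reverse (List.replicate k 0) ?_
  simpa using h

theorem left_cut (n j : ℕ) (hj : j ≤ n) (hn : 1 ≤ n) (u x v : List ℕ)
    (h : u ++ x ++ v = List.replicate n 0 ++ List.replicate n 1 ++
          List.replicate n 0 ++ List.replicate n 1)
    (hu : u.length = n + j) (hv : v.length < 2 * n) :
    u = List.replicate n 0 ++ List.replicate j 1 ∧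
    ∃ t, x = List.replicate (n - j) 1 ++ 0 :: t := by
  have e : List.replicate n 1 = List.replicate j 1 ++ List.replicate (n - j) 1 := by
    rw [← List.replicate_add]; congr 1; omega
  obtain ⟨n', rfl⟩ := Nat.exists_eq_add_of_le' hn
  have h' : u ++ (x ++ v) = (List.replicate (n'+1) 0 ++ List.replicate j 1) ++
      ((List.replicate (n'+1-j) 1 ++ [0]) ++ (List.replicate n' 0 ++ List.replicate (n'+1) 1)) := by
    rw [← List.append_assoc, h]
    have e2 : List.replicate (n'+1) 0 = 0 :: List.replicate n' 0 := List.replicate_succ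
    calc _ = List.replicate (n'+1) 0 ++ (List.replicate j 1 ++ List.replicate (n'+1-j) 1) ++
          (0 :: List.replicate n' 0) ++ List.replicate (n'+1) 1 := by
            rw [← e, ← e2]
      _ = _ := by simp only [List.append_assoc, List.cons_append, List.nil_append]
  obtain ⟨h1, h2⟩ := List.append_inj h' (by simp [hu])
  refine ⟨h1, ?_⟩
  have hl := congrArg List.length h2
  simp at hl
  have hpre : List.replicate (n'+1-j) 1 ++ [0] <+: x := by
    refine List.prefix_of_prefix_length_le (l₃ := x ++ v) ⟨_, h2.symm⟩ ⟨_, rfl⟩ ?_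
    simp
    omega
  obtain ⟨t, ht⟩ := hpre
  exact ⟨t, by rw [← ht]; simp⟩

theorem right_cut (n j : ℕ) (hj : j ≤ n) (hn : 1 ≤ n) (u x v : List ℕ)
    (h : u ++ x ++ v = List.replicate n 0 ++ List.replicate n 1 ++
          List.replicate n 0 ++ List.replicate n 1)
    (hv : v.length = n + j) (hu : u.length < 2 * n) :
    v = List.replicate j 0 ++ List.replicate n 1 ∧
    ∃ t, x = t ++ 1 :: List.replicate (n - j) 0 := by
  have e : List.replicate n 0 = List.replicate (n - j) 0 ++ List.replicate j 0 := by
    rw [← List.replicate_add]; congr 1; omega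
  obtain ⟨n', rfl⟩ := Nat.exists_eq_add_of_le' hn
  have h' : (u ++ x) ++ v = ((List.replicate (n'+1) 0 ++ List.replicate n' 1) ++
      (1 :: List.replicate (n'+1-j) 0)) ++ (List.replicate j 0 ++ List.replicate (n'+1) 1) := by
    rw [h]
    have e2 : List.replicate (n'+1) 1 = List.replicate n' 1 ++ [1] := List.replicate_succ'
    calc _ = List.replicate (n'+1) 0 ++ (List.replicate n' 1 ++ [1]) ++
          (List.replicate (n'+1-j) 0 ++ List.replicate j 0) ++ List.replicate (n'+1) 1 := by
            rw [← e, ← e2]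
      _ = _ := by simp only [List.append_assoc, List.cons_append, List.nil_append]
  obtain ⟨h1, h2⟩ := List.append_inj' h' (by simp [hv]; omega)
  refine ⟨h2, ?_⟩
  have hl := congrArg List.length h1
  simp at hl
  have hpre : (1 :: List.replicate (n'+1-j) 0) <:+ x := by
    refine List.suffix_of_suffix_length_le (l₃ := u ++ x) ⟨_, h1.symm⟩ ⟨_, rfl⟩ ?_
    simp
    omega
  obtain ⟨t, ht⟩ := hpre
  exact ⟨t, by rw [← ht]⟩

theorem not_linear : anbnambm ∉ LinFam ℕ := by
  rintro ⟨G, hG, hE⟩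
  have hmem : ∀ w, w ≠ [] → (Gen G.rules G.start w ↔ w ∈ anbnambm) := by
    intro w hw
    rw [← lang_iff G hG]
    have := Set.ext_iff.mp hE w
    simpa [hw] using this
  obtain ⟨K, hK⟩ : ∃ K, ∀ r ∈ G.rules, r.2.length ≤ K := by
    refine ⟨(G.rules.map (fun r => r.2.length)).sum, fun r hr => ?_⟩
    exact List.single_le_sum (by simp) _ (List.mem_map_of_mem (f := fun r => r.2.length) hr)
  have key : ∀ n, ∃ (u v x : List ℕ) (B : ℕ), K < n →
      u ++ x ++ v = List.replicate n 0 ++ List.replicate n 1 ++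
          List.replicate n 0 ++ List.replicate n 1 ∧ Gen G.rules B x ∧
        B ∈ G.rules.map Prod.fst ∧
        (∀ y, Gen G.rules B y → Gen G.rules G.start (u ++ y ++ v)) ∧
        u.length ≤ n + K ∧ v.length ≤ n + K ∧
        (n < u.length ∨ n < v.length) := by
    intro n
    by_cases hn : K < n
    · have hne : List.replicate n 0 ++ List.replicate n 1 ++
          List.replicate n 0 ++ List.replicate n 1 ≠ [] := by
        simp; omega
      have hg := (hmem _ hne).2 ⟨n, n, by omega, by omega, rfl⟩
      obtain ⟨u, v, x, B, h1, h2⟩ := cut G.rules G.start n K hK _ _ hg [] [] (by simp) (by simp)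
        (by simp) (by simp; omega)
      exact ⟨u, v, x, B, fun _ => ⟨by simpa using h1, h2⟩⟩
    · exact ⟨[], [], [], 0, fun h => absurd h hn⟩
  choose u v x B hk using key
  let T : Set (ℕ × ℕ × ℕ) :=
    {B | B ∈ G.rules.map Prod.fst} ×ˢ (Set.Iic K ×ˢ Set.Iic K)
  have hT : T.Finite := (List.finite_toSet _).prod ((Set.finite_Iic K).prod (Set.finite_Iic K))
  obtain ⟨n, hn, m, hm, hnm, hf⟩ := (Set.Ioi_infinite K).exists_ne_map_eq_of_mapsTo
    (f := fun n => (B n, (u n).length - n, (v n).length - n)) (t := T) (by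
      intro n hn
      obtain ⟨_, _, h3, _, h5, h6, _⟩ := hk n hn
      refine ⟨h3, ?_, ?_⟩
      · simp; omega
      · simp; omega) hT
  simp only [Prod.mk.injEq] at hf
  obtain ⟨hB, hU, hV⟩ := hf
  simp only [Set.mem_Ioi] at hn hm
  obtain ⟨a1, a2, a3, a4, a5, a6, a7⟩ := hk n hn
  obtain ⟨b1, b2, b3, b4, b5, b6, b7⟩ := hk m hm
  have hg := a4 (x m) (by rw [hB]; exact b2)
  have hl : u n ++ x m ++ v n ∈ anbnambm := by
    refine (hmem _ ?_).1 hg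
    intro h
    simp at h
    rcases a7 with h7 | h7 <;> simp [h] at h7
  rcases a7 with h7 | h7
  · obtain ⟨c1, -⟩ := left_cut n ((u n).length - n) (by omega) (by omega) _ _ _ a1
      (by omega) (by omega)
    obtain ⟨-, t, d2⟩ := left_cut m ((u n).length - n) (by omega) (by omega) _ _ _ b1
      (by omega) (by omega)
    set j := (u n).length - n with hj
    rw [c1, d2] at hl
    refine hnm (left_lang n m (by omega) (t ++ v n) ?_)
    have e : List.replicate m 1 = List.replicate j 1 ++ List.replicate (m - j) 1 := by
      rw [← List.replicate_add]; congr 1; omega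
    rw [e]
    simpa only [List.append_assoc, List.cons_append, List.nil_append] using hl
  · obtain ⟨c1, -⟩ := right_cut n ((v n).length - n) (by omega) (by omega) _ _ _ a1
      (by omega) (by omega)
    obtain ⟨-, t, d2⟩ := right_cut m ((v n).length - n) (by omega) (by omega) _ _ _ b1
      (by omega) (by omega)
    set j := (v n).length - n with hj
    rw [c1, d2] at hl
    refine hnm (right_lang n m (by omega) (u n ++ t) ?_)
    have e : List.replicate m 0 = List.replicate (m - j) 0 ++ List.replicate j 0 := by
      rw [← List.replicate_add]; congr 1; omega
    rw [e]
    simpa only [List.append_assoc, List.cons_append, List.nil_append] using hl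

/-! ### The CD grammar system -/

def cdG : CDGS ℕ where
  deg := 3
  start := 0
  comp := ![
    [(0, [Sum.inl 1, Sum.inl 3]), (2, [Sum.inl 1])],
    [(1, [Sum.inr 0, Sum.inl 2, Sum.inr 1]), (1, [Sum.inr 0, Sum.inr 1]), (4, [Sum.inl 3])],
    [(3, [Sum.inr 0, Sum.inl 4, Sum.inr 1]), (3, [Sum.inr 0, Sum.inr 1])]]

def Dyck1 : Language ℕ := {w | ∃ n, 1 ≤ n ∧ w = List.replicate n 0 ++ List.replicate n 1}

def sem : Symb ℕ → Language ℕ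
  | .inl 0 => anbnambm
  | .inl _ => Dyck1
  | .inr a => ({[a]} : Set (List ℕ))

def semF (x : SForm ℕ) : Language ℕ := (x.map sem).prod

theorem sem_term (w v : List ℕ) : v ∈ semF (w.map Sum.inr) ↔ v = w := by
  induction w generalizing v with
  | nil => simp [semF, Language.mem_one]
  | cons a w ih =>
    have : semF ((a :: w).map Sum.inr) = sem (Sum.inr a) * semF (w.map Sum.inr) := by
      simp [semF]
    rw [this, Language.mem_mul]
    constructor
    · rintro ⟨p, hp, q, hq, rfl⟩
      have hp : p = [a] := hp
      rw [(ih q).1 hq, hp]; rfl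
    · rintro rfl
      exact ⟨[a], rfl, w, (ih w).2 rfl, rfl⟩

theorem dyck_wrap (w : List ℕ) (h : w ∈ Dyck1) : [0] ++ (w ++ [1]) ∈ Dyck1 := by
  obtain ⟨n, hn, rfl⟩ := h
  exact ⟨n + 1, by omega, by simp [List.replicate_succ, ← List.replicate_succ']⟩

theorem semF_wrap (A : ℕ) (hA : sem (Sum.inl A) = Dyck1) :
    semF [Sum.inr 0, Sum.inl A, Sum.inr 1] ≤ Dyck1 := by
  intro w hw
  simp only [semF, List.map_cons, List.map_nil, List.prod_cons, List.prod_nil, mul_one, hA] at hw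
  obtain ⟨p, hp, q, hq, rfl⟩ := Language.mem_mul.1 hw
  obtain ⟨q, hq', s, hs, rfl⟩ := Language.mem_mul.1 hq
  have hp : p = [0] := hp
  have hs : s = [1] := hs
  subst hp hs
  exact dyck_wrap _ hq'

theorem semF_base : semF [Sum.inr 0, Sum.inr 1] ≤ Dyck1 := by
  intro w hw
  have := (sem_term [0, 1] w).1 hw
  exact ⟨1, le_rfl, this⟩

theorem rule_sound (i : Fin 3) (r : Rule ℕ) (hr : r ∈ cdG.comp i) :
    semF r.2 ≤ sem (Sum.inl r.1) := by
  fin_cases i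
  · simp [cdG] at hr
    rcases hr with rfl | rfl
    · intro w hw
      simp only [semF, List.map_cons, List.map_nil, List.prod_cons, List.prod_nil, mul_one] at hw
      obtain ⟨p, ⟨n, hn, rfl⟩, q, ⟨m, hm, rfl⟩, rfl⟩ := Language.mem_mul.1 hw
      exact ⟨n, m, hn, hm, by simp⟩
    · simp only [semF, List.map_cons, List.map_nil, List.prod_cons, List.prod_nil, mul_one]
      exact le_refl Dyck1
  · simp [cdG] at hr
    rcases hr with rfl | rfl | rfl
    · exact semF_wrap 2 rfl
    · exact semF_base
    · simp only [semF, List.map_cons, List.map_nil, List.prod_cons, List.prod_nil, mul_one]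
      exact le_refl Dyck1
  · simp [cdG] at hr
    rcases hr with rfl | rfl
    · exact semF_wrap 4 rfl
    · exact semF_base

theorem modeStep_iff_aux (G : CDGS ℕ) (x y : SForm ℕ)
    (h : G.ModeStep (Mode.conj Mode.t (Mode.eq 1)) x y) : ∃ i, RStep (G.comp i) x y := by
  obtain ⟨i, m, h1, h2, h3⟩ := h
  have h3 : m = 1 := h3
  subst h3
  obtain ⟨z, hz, hzy⟩ := h1
  have hzy : z = y := hzy
  exact ⟨i, hzy ▸ hz⟩

theorem cd_sound (w : List ℕ) (h : w ∈ cdG.lang (Mode.conj Mode.t (Mode.eq 1))) :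
    w ∈ anbnambm := by
  have key : ∀ x y, Relation.TransGen (cdG.ModeStep (Mode.conj Mode.t (Mode.eq 1))) x y →
      semF y ≤ semF x := by
    have one : ∀ x y, cdG.ModeStep (Mode.conj Mode.t (Mode.eq 1)) x y → semF y ≤ semF x := by
      intro x y h
      obtain ⟨i, r, hr, p, q, rfl, rfl⟩ := modeStep_iff_aux _ _ _ h
      have := rule_sound i r hr
      simp only [semF, List.map_append, List.prod_append, List.map_cons, List.prod_cons] at this ⊢
      rw [mul_assoc]
      exact mul_le_mul' le_rfl (mul_le_mul' this le_rfl)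
    intro x y h
    induction h with
    | single h => exact one _ _ h
    | tail _ h ih => exact (one _ _ h).trans ih
  have := key _ _ h ((sem_term w w).2 rfl)
  simp only [semF, List.map_cons, List.map_nil, List.prod_cons, List.prod_nil, mul_one] at this
  exact this

theorem mk_step (G : CDGS ℕ) (i : Fin G.deg) (r : Rule ℕ) (hr : r ∈ G.comp i) (u v x y : SForm ℕ)
    (hx : x = u ++ Sum.inl r.1 :: v) (hy : y = u ++ r.2 ++ v)
    (hno : ∀ s ∈ G.comp i, (Sum.inl s.1 : Symb ℕ) ∉ y) :
    G.ModeStep (Mode.conj Mode.t (Mode.eq 1)) x y := by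
  refine ⟨i, 1, ⟨y, ⟨r, hr, u, v, hx, hy⟩, rfl⟩, ?_, rfl⟩
  rintro ⟨z, s, hs, p, q, h1, -⟩
  exact hno s hs (by rw [h1]; simp)

abbrev RT (a : ℕ) (n : ℕ) : SForm ℕ := List.replicate n (Sum.inr a)

abbrev CStep := cdG.ModeStep (Mode.conj Mode.t (Mode.eq 1))

theorem cd_A (n : ℕ) : Relation.TransGen CStep [Sum.inl 0]
    (RT 0 n ++ Sum.inl 1 :: (RT 1 n ++ [Sum.inl 3])) := by
  induction n with
  | zero =>
    refine Relation.TransGen.single (mk_step cdG (0 : Fin 3) (0, [Sum.inl 1, Sum.inl 3])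
      (by simp [cdG]) [] [] _ _ rfl rfl (by simp [cdG]))
  | succ n ih =>
    have s1 : CStep (RT 0 n ++ Sum.inl 1 :: (RT 1 n ++ [Sum.inl 3]))
        (RT 0 (n+1) ++ Sum.inl 2 :: (RT 1 (n+1) ++ [Sum.inl 3])) :=
      mk_step cdG (1 : Fin 3) (1, [Sum.inr 0, Sum.inl 2, Sum.inr 1])
        (by simp [cdG]) (RT 0 n) (RT 1 n ++ [Sum.inl 3]) _ _ rfl
        (by rw [RT, List.replicate_succ', RT, List.replicate_succ]; simp) (by simp [cdG])
    have s2 : CStep (RT 0 (n+1) ++ Sum.inl 2 :: (RT 1 (n+1) ++ [Sum.inl 3]))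
        (RT 0 (n+1) ++ Sum.inl 1 :: (RT 1 (n+1) ++ [Sum.inl 3])) :=
      mk_step cdG (0 : Fin 3) (2, [Sum.inl 1])
        (by simp [cdG]) (RT 0 (n+1)) (RT 1 (n+1) ++ [Sum.inl 3]) _ _ rfl
        (by simp) (by simp [cdG])
    exact (ih.tail s1).tail s2

theorem cd_B (n m : ℕ) : Relation.TransGen CStep [Sum.inl 0]
    (RT 0 (n+1) ++ RT 1 (n+1) ++ RT 0 m ++ Sum.inl 3 :: RT 1 m) := by
  induction m with
  | zero =>
    refine (cd_A n).tail (mk_step cdG (1 : Fin 3) (1, [Sum.inr 0, Sum.inr 1])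
      (by simp [cdG]) (RT 0 n) (RT 1 n ++ [Sum.inl 3]) _ _ rfl
      (by rw [RT, List.replicate_succ', RT, List.replicate_succ]; simp) (by simp [cdG]))
  | succ m ih =>
    have s1 : CStep (RT 0 (n+1) ++ RT 1 (n+1) ++ RT 0 m ++ Sum.inl 3 :: RT 1 m)
        (RT 0 (n+1) ++ RT 1 (n+1) ++ RT 0 (m+1) ++ Sum.inl 4 :: RT 1 (m+1)) :=
      mk_step cdG (2 : Fin 3) (3, [Sum.inr 0, Sum.inl 4, Sum.inr 1])
        (by simp [cdG]) (RT 0 (n+1) ++ RT 1 (n+1) ++ RT 0 m) (RT 1 m) _ _ rfl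
        (by rw [RT, RT, RT, RT, List.replicate_succ' (n := m), List.replicate_succ (n := m)]; simp)
        (by simp [cdG])
    have s2 : CStep (RT 0 (n+1) ++ RT 1 (n+1) ++ RT 0 (m+1) ++ Sum.inl 4 :: RT 1 (m+1))
        (RT 0 (n+1) ++ RT 1 (n+1) ++ RT 0 (m+1) ++ Sum.inl 3 :: RT 1 (m+1)) :=
      mk_step cdG (1 : Fin 3) (4, [Sum.inl 3])
        (by simp [cdG]) (RT 0 (n+1) ++ RT 1 (n+1) ++ RT 0 (m+1)) (RT 1 (m+1)) _ _ rfl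
        (by simp) (by simp [cdG])
    exact (ih.tail s1).tail s2

theorem cd_complete (w : List ℕ) (h : w ∈ anbnambm) :
    w ∈ cdG.lang (Mode.conj Mode.t (Mode.eq 1)) := by
  obtain ⟨n, m, hn, hm, rfl⟩ := h
  obtain ⟨n, rfl⟩ := Nat.exists_eq_add_of_le' hn
  obtain ⟨m, rfl⟩ := Nat.exists_eq_add_of_le' hm
  refine (cd_B n m).tail (mk_step cdG (2 : Fin 3) (3, [Sum.inr 0, Sum.inr 1])
      (by simp [cdG]) (RT 0 (n+1) ++ RT 1 (n+1) ++ RT 0 m) (RT 1 m) _ _ rfl ?_ (by simp [cdG]))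
  rw [List.replicate_succ' (n := m), List.replicate_succ (n := m)]
  simp

theorem in_CD : anbnambm ∈ CDFam ℕ true 3 (Mode.conj Mode.t (Mode.eq 1)) := by
  refine ⟨cdG, le_rfl, fun _ => ?_, ?_⟩
  · intro i r hr
    change Fin 3 at i
    fin_cases i <;> simp [cdG] at hr
    · rcases hr with rfl | rfl <;> simp
    · rcases hr with rfl | rfl | rfl <;> simp
    · rcases hr with rfl | rfl <;> simp
  · have : cdG.lang (Mode.conj Mode.t (Mode.eq 1)) = anbnambm :=
      Set.ext fun w => ⟨cd_sound w, cd_complete w⟩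
    rw [EqL, this]

end Aux

/-- { aⁿbⁿaᵐbᵐ | n, m ≥ 1 } is not linear context-free, but it
belongs to L(CD_3, CF−λ, (t∧=1)). -/
theorem stmt12 :
    anbnambm ∉ LinFam ℕ ∧
    anbnambm ∈ CDFam ℕ true 3 (Mode.conj Mode.t (Mode.eq 1)) :=
  ⟨not_linear, in_CD⟩

end CDHybrid
end
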